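/- ∫₀¹ (K(1−x)·Li₂(x))/x dx = −32π·Im(Li₃((1+i)/2)) + 32·Li₄(1/2) + 41π⁴/90 + (4/3)·log⁴2 − (1/3)·π²·log²2. -/

import Mathlib

/-- Catalan's constant `C = ∑_{k≥0} (-1)^k/(2k+1)²`. -/
noncomputable def catalanConst : ℝ := ∑' k : ℕ, (-1 : ℝ) ^ k / ((2 * k + 1 : ℕ) : ℝ) ^ 2

/-- `β(4) = ∑_{k≥0} (-1)^k/(2k+1)⁴`. -/
noncomputable def diriBeta4 : ℝ := ∑' k : ℕ, (-1 : ℝ) ^ k / ((2 * k + 1 : ℕ) : ℝ) ^ 4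

/-- The real polylogarithm `Li_s(x) = ∑_{n≥1} xⁿ/n^s`. -/
noncomputable def rpolylog (s : ℕ) (x : ℝ) : ℝ :=
  ∑' n : ℕ, x ^ (n + 1) / ((n + 1 : ℕ) : ℝ) ^ s

/-- The complex polylogarithm `Li_s(z) = ∑_{n≥1} zⁿ/n^s`. -/
noncomputable def cpolylog (s : ℕ) (z : ℂ) : ℂ :=
  ∑' n : ℕ, z ^ (n + 1) / ((n + 1 : ℕ) : ℂ) ^ s

/-- The complete elliptic integral of the first kind,
`K(m) = ∫₀^{π/2} (1 - m sin²θ)^{-1/2} dθ`. -/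
noncomputable def ellipticK (m : ℝ) : ℝ :=
  ∫ θ in (0 : ℝ)..(Real.pi / 2), 1 / Real.sqrt (1 - m * Real.sin θ ^ 2)

section

open MeasureTheory Set Real Filter Topology

theorem image_exp_neg_Ioi_zero : (fun t : ℝ => exp (-t)) '' Ioi 0 = Ioo 0 1 := by
  ext y
  simp only [mem_image, mem_Ioi, mem_Ioo]
  constructor
  · rintro ⟨t, ht, rfl⟩
    exact ⟨exp_pos _, by simpa using ht⟩
  · rintro ⟨h0, h1⟩
    exact ⟨-log y, by simpa using log_neg h0 h1, by simp [exp_log h0]⟩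

theorem hasDerivWithinAt_exp_neg (s : Set ℝ) (x : ℝ) :
    HasDerivWithinAt (fun t : ℝ => exp (-t)) (-exp (-x)) s x := by
  simpa using ((hasDerivAt_id x).neg.exp).hasDerivWithinAt

theorem injOn_exp_neg (s : Set ℝ) : InjOn (fun t : ℝ => exp (-t)) s :=
  fun a _ b _ h => by simpa using h

theorem integral_Ioo_zero_one_eq_exp_neg {E : Type*} [NormedAddCommGroup E] [NormedSpace ℝ E]
    (g : ℝ → E) :
    ∫ y in Ioo (0 : ℝ) 1, g y = ∫ t in Ioi (0 : ℝ), exp (-t) • g (exp (-t)) := by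
  rw [← image_exp_neg_Ioi_zero, integral_image_eq_integral_abs_deriv_smul measurableSet_Ioi
    (fun x _ => hasDerivWithinAt_exp_neg _ x) (injOn_exp_neg _)]
  simp [abs_of_pos (exp_pos _)]

theorem integrableOn_Ioo_zero_one_iff_exp_neg {E : Type*} [NormedAddCommGroup E] [NormedSpace ℝ E]
    (g : ℝ → E) :
    IntegrableOn g (Ioo (0 : ℝ) 1) ↔
      IntegrableOn (fun t => exp (-t) • g (exp (-t))) (Ioi (0 : ℝ)) := by
  rw [← image_exp_neg_Ioi_zero, integrableOn_image_iff_integrableOn_abs_deriv_smul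
    measurableSet_Ioi (fun x _ => hasDerivWithinAt_exp_neg _ x) (injOn_exp_neg _)]
  simp [abs_of_pos (exp_pos _)]

theorem integrableOn_pow_mul_log_pow (n k : ℕ) :
    IntegrableOn (fun x : ℝ => x ^ n * log x ^ k) (Ioo 0 1) := by
  rw [integrableOn_Ioo_zero_one_iff_exp_neg]
  have h := integrableOn_rpow_mul_exp_neg_mul_rpow (p := 1) (s := k) (b := n + 1)
    (by have := k.cast_nonneg (α := ℝ); linarith) one_pos (by positivity)
  refine IntegrableOn.congr_fun (h.const_mul ((-1 : ℝ) ^ k)) (fun t ht => ?_) measurableSet_Ioi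
  simp only [rpow_natCast, rpow_one, log_exp, smul_eq_mul, ← exp_nat_mul]
  have : exp (-(n + 1) * t) = exp (-t) * exp (n * -t) := by rw [← exp_add]; congr 1; ring
  rw [this, neg_pow t]
  ring

theorem integral_pow_mul_log_pow (n k : ℕ) :
    ∫ x in Ioo (0 : ℝ) 1, x ^ n * log x ^ k = (-1) ^ k * k.factorial / (n + 1) ^ (k + 1) := by
  rw [integral_Ioo_zero_one_eq_exp_neg]
  have h := Real.integral_rpow_mul_exp_neg_mul_Ioi (a := k + 1) (r := n + 1) (by positivity)
    (by positivity)
  rw [Gamma_nat_eq_factorial, show ((k : ℝ) + 1) = ((k + 1 : ℕ) : ℝ) by push_cast; ring,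
    rpow_natCast] at h
  have : (-1 : ℝ) ^ k * k.factorial / (n + 1) ^ (k + 1) =
      (-1) ^ k * ((1 / (n + 1 : ℝ)) ^ (k + 1) * k.factorial) := by
    rw [one_div, inv_pow]; field_simp
  rw [this, ← h, ← integral_const_mul]
  refine setIntegral_congr_fun measurableSet_Ioi (fun t ht => ?_)
  simp only [log_exp, smul_eq_mul, ← exp_nat_mul]
  have : exp (-((n + 1) * t)) = exp (-t) * exp (n * -t) := by rw [← exp_add]; congr 1; ring
  rw [this, neg_pow t, show (((k + 1 : ℕ) : ℝ) - 1) = (k : ℝ) by push_cast; ring, rpow_natCast]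
  ring

/-- Termwise integration, with integrability of the sum. -/
theorem integrable_and_hasSum_integral {α E : Type*} [MeasurableSpace α] [NormedAddCommGroup E]
    [NormedSpace ℝ E] [CompleteSpace E] {μ : Measure α} {s : Set α} (hs : MeasurableSet s)
    {f : ℕ → α → E} {F : α → E} {c : ℕ → ℝ}
    (hf : ∀ n, IntegrableOn (f n) s μ) (hle : ∀ n, ∫ x in s, ‖f n x‖ ∂μ ≤ c n)
    (hc : Summable c) (hF : ∀ x ∈ s, HasSum (fun n => f n x) (F x)) :
    IntegrableOn F s μ ∧ HasSum (fun n => ∫ x in s, f n x ∂μ) (∫ x in s, F x ∂μ) := by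
  have hsum : Summable fun n => ∫ x in s, ‖f n x‖ ∂μ :=
    hc.of_nonneg_of_le (fun n => integral_nonneg fun _ => norm_nonneg _) hle
  have hFae : ∀ᵐ x ∂(μ.restrict s), HasSum (fun n => f n x) (F x) :=
    (ae_restrict_iff' hs).2 (Eventually.of_forall hF)
  constructor
  · refine ⟨?_, ?_⟩
    · refine aestronglyMeasurable_of_tendsto_ae atTop
        (f := fun N x => ∑ n ∈ Finset.range N, f n x) (fun N => ?_) ?_
      · exact Finset.aestronglyMeasurable_fun_sum _ fun n _ => (hf n).aestronglyMeasurable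
      · filter_upwards [hFae] with x hx using hx.tendsto_sum_nat
    · rw [hasFiniteIntegral_iff_enorm]
      calc ∫⁻ x in s, ‖F x‖ₑ ∂μ ≤ ∫⁻ x in s, ∑' n, ‖f n x‖ₑ ∂μ := by
            refine lintegral_mono_ae ?_
            filter_upwards [hFae] with x hx
            refine le_of_tendsto_of_tendsto' hx.tendsto_sum_nat.enorm
              (ENNReal.summable.hasSum.tendsto_sum_nat) (fun N => ?_)
            exact enorm_sum_le _ _
        _ = ∑' n, ∫⁻ x in s, ‖f n x‖ₑ ∂μ :=
            lintegral_tsum fun n => (hf n).aestronglyMeasurable.enorm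
        _ = ∑' n, ENNReal.ofReal (∫ x in s, ‖f n x‖ ∂μ) := by
            congr 1; ext n
            exact (ofReal_integral_norm_eq_lintegral_enorm (hf n)).symm
        _ < ⊤ := hsum.tsum_ofReal_lt_top
  · have h := hasSum_integral_of_summable_integral_norm hf hsum
    rwa [integral_congr_ae (g := F)] at h
    filter_upwards [hFae] with x hx using hx.tsum_eq


/-- `f` is integrable on `s`, with integral `v`. -/
def HasIntegralOn {E : Type*} [NormedAddCommGroup E] [NormedSpace ℝ E] (f : ℝ → E) (s : Set ℝ)
    (v : E) : Prop :=
  IntegrableOn f s ∧ ∫ x in s, f x = v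

namespace HasIntegralOn

variable {E : Type*} [NormedAddCommGroup E] [NormedSpace ℝ E] {f g : ℝ → E} {s : Set ℝ} {v w : E}

theorem add (hf : HasIntegralOn f s v) (hg : HasIntegralOn g s w) :
    HasIntegralOn (fun x => f x + g x) s (v + w) :=
  ⟨hf.1.add hg.1, by rw [integral_add hf.1 hg.1, hf.2, hg.2]⟩

theorem sub (hf : HasIntegralOn f s v) (hg : HasIntegralOn g s w) :
    HasIntegralOn (fun x => f x - g x) s (v - w) :=
  ⟨hf.1.sub hg.1, by rw [integral_sub hf.1 hg.1, hf.2, hg.2]⟩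

theorem const_mul {f : ℝ → ℝ} {v : ℝ} (c : ℝ) (hf : HasIntegralOn f s v) :
    HasIntegralOn (fun x => c * f x) s (c * v) :=
  ⟨hf.1.const_mul c, by rw [integral_const_mul, hf.2]⟩

theorem congr (hf : HasIntegralOn f s v) (hs : MeasurableSet s) (h : ∀ x ∈ s, g x = f x)
    (hv : w = v) : HasIntegralOn g s w :=
  ⟨hf.1.congr_fun (fun x hx => (h x hx).symm) hs,
    by rw [setIntegral_congr_fun hs h, hf.2, hv]⟩

theorem of_eq (hf : HasIntegralOn f s v) (h : v = w) : HasIntegralOn f s w := h ▸ hf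

theorem unique (hf : HasIntegralOn f s v) (hg : HasIntegralOn f s w) : v = w := hf.2.symm.trans hg.2

end HasIntegralOn

theorem hasIntegralOn_self {E : Type*} [NormedAddCommGroup E] [NormedSpace ℝ E] {f : ℝ → E}
    {s : Set ℝ} (hf : IntegrableOn f s) : HasIntegralOn f s (∫ x in s, f x) := ⟨hf, rfl⟩

/-- Fundamental theorem of calculus on an open interval, from one-sided limits. -/
theorem hasIntegralOn_Ioo_of_hasDerivAt {E : Type*} [NormedAddCommGroup E] [NormedSpace ℝ E]
    [CompleteSpace E] {a b : ℝ} (hab : a < b) {f f' : ℝ → E} {u v : E}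
    (hd : ∀ x ∈ Ioo a b, HasDerivAt f (f' x) x) (hi : IntegrableOn f' (Ioo a b))
    (ha : Tendsto f (𝓝[>] a) (𝓝 u)) (hb : Tendsto f (𝓝[<] b) (𝓝 v)) :
    HasIntegralOn f' (Ioo a b) (v - u) := by
  refine ⟨hi, ?_⟩
  rw [← integral_Ioc_eq_integral_Ioo, ← intervalIntegral.integral_of_le hab.le]
  exact intervalIntegral.integral_eq_sub_of_hasDerivAt_of_tendsto hab hd
    ((intervalIntegrable_iff_integrableOn_Ioo_of_le hab.le).2 hi) ha hb

theorem integrableOn_Ioo_of_continuousOn_Icc {a b : ℝ} {E : Type*} [NormedAddCommGroup E]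
    {f : ℝ → E} (hc : ContinuousOn f (Icc a b)) : IntegrableOn f (Ioo a b) :=
  hc.integrableOn_Icc.mono_set Ioo_subset_Icc_self

/-- Fundamental theorem of calculus on a closed interval. -/
theorem hasIntegralOn_Ioo_of_hasDerivAt_Icc {E : Type*} [NormedAddCommGroup E] [NormedSpace ℝ E]
    [CompleteSpace E] {a b : ℝ} (hab : a ≤ b) {f f' : ℝ → E}
    (hd : ∀ x ∈ Icc a b, HasDerivAt f (f' x) x) (hc : ContinuousOn f' (Icc a b)) :
    HasIntegralOn f' (Ioo a b) (f b - f a) := by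
  refine ⟨integrableOn_Ioo_of_continuousOn_Icc hc, ?_⟩
  rw [← integral_Ioc_eq_integral_Ioo, ← intervalIntegral.integral_of_le hab]
  rw [← uIcc_of_le hab] at hd hc
  exact intervalIntegral.integral_eq_sub_of_hasDerivAt hd hc.intervalIntegrable

theorem hasSum_one_div_odd_pow {k : ℕ} {A : ℝ}
    (h : HasSum (fun n : ℕ => 1 / ((n : ℝ) + 1) ^ k) A) :
    HasSum (fun n : ℕ => 1 / (2 * (n : ℝ) + 1) ^ k) (A - A / 2 ^ k) ∧
      HasSum (fun n : ℕ => (-1 : ℝ) ^ n / ((n : ℝ) + 1) ^ k) (A - 2 * (A / 2 ^ k)) := by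
  have hodd : Summable (fun n : ℕ => 1 / (2 * (n : ℝ) + 1) ^ k) := by
    have := h.summable.comp_injective (i := fun n : ℕ => 2 * n) (fun a b h => by simpa using h)
    refine this.congr fun n => ?_
    simp
  have heven : HasSum (fun n : ℕ => 1 / (2 * (n : ℝ) + 2) ^ k) (A / 2 ^ k) := by
    refine (h.div_const (2 ^ k)).congr_fun fun n => ?_
    rw [div_div, ← mul_pow]; ring_nf
  have h1 : HasSum (fun n : ℕ => 1 / ((n : ℝ) + 1) ^ k)
      ((∑' n : ℕ, 1 / (2 * (n : ℝ) + 1) ^ k) + A / 2 ^ k) := by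
    refine HasSum.even_add_odd ?_ ?_
    · simpa using hodd.hasSum
    · refine heven.congr_fun fun n => ?_
      push_cast; ring_nf
  have h2 : ∑' n : ℕ, 1 / (2 * (n : ℝ) + 1) ^ k = A - A / 2 ^ k := by
    linarith [h.unique h1]
  have h3 : HasSum (fun n : ℕ => 1 / (2 * (n : ℝ) + 1) ^ k) (A - A / 2 ^ k) := h2 ▸ hodd.hasSum
  refine ⟨h3, ?_⟩
  rw [show A - 2 * (A / 2 ^ k) = (A - A / 2 ^ k) + -(A / 2 ^ k) by ring]
  refine HasSum.even_add_odd ?_ ?_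
  · simpa using h3
  · refine heven.neg.congr_fun fun n => ?_
    rw [pow_succ, pow_mul]; push_cast; norm_num; ring_nf

theorem hasSum_one_div_succ_sq : HasSum (fun n : ℕ => 1 / ((n : ℝ) + 1) ^ 2) (π ^ 2 / 6) := by
  have := (hasSum_nat_add_iff' 1).2 hasSum_zeta_two
  simpa using this

theorem hasSum_one_div_succ_pow_four :
    HasSum (fun n : ℕ => 1 / ((n : ℝ) + 1) ^ 4) (π ^ 4 / 90) := by
  have := (hasSum_nat_add_iff' 1).2 hasSum_zeta_four
  simpa using this

theorem summable_one_div_succ_pow {k : ℕ} (hk : 1 < k) :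
    Summable (fun n : ℕ => 1 / ((n : ℝ) + 1) ^ k) := by
  have := (summable_nat_add_iff 1).2 (Real.summable_one_div_nat_pow.2 hk)
  simpa using this

set_option maxHeartbeats 1000000 in
theorem hasSum_shuffle {s A : ℝ} (hs : 0 < s) {h : ℕ → ℝ}
    (hA : HasSum (fun m : ℕ => 1 / ((m : ℝ) + s) ^ 2) A)
    (hh : ∀ m : ℕ, HasSum (fun k : ℕ => 1 / ((k : ℝ) + s) - 1 / (k + m + 2 * s)) (h m)) :
    HasSum (fun m : ℕ => h m / ((m : ℝ) + s) ^ 3) (A ^ 2 / 2) := by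
  obtain ⟨G, hG⟩ : ∃ G : ℕ × ℕ → ℝ, ∀ p, G p =
      1 / (((p.1 : ℝ) + s) ^ 2 * (p.2 + s) * (p.1 + p.2 + 2 * s)) := ⟨_, fun _ => rfl⟩
  have hG0 : ∀ p, 0 ≤ G p := fun p => by rw [hG]; positivity
  have hGs : ∀ p, G p + G p.swap = 1 / ((p.1 : ℝ) + s) ^ 2 * (1 / ((p.2 : ℝ) + s) ^ 2) := by
    rintro ⟨m, k⟩
    have h1 : (m : ℝ) + s ≠ 0 := by positivity
    have h2 : (k : ℝ) + s ≠ 0 := by positivity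
    have h3 : (m : ℝ) + k + 2 * s ≠ 0 := by positivity
    have h4 : (k : ℝ) + m + 2 * s ≠ 0 := by positivity
    simp only [hG, Prod.fst_swap, Prod.snd_swap]
    field_simp
    ring
  have hprod : HasSum (fun p : ℕ × ℕ => 1 / ((p.1 : ℝ) + s) ^ 2 * (1 / ((p.2 : ℝ) + s) ^ 2))
      (A * A) := by
    have h0 : ∀ f : ℕ → ℝ, 0 ≤ f → HasSum f A →
        HasSum (fun p : ℕ × ℕ => f p.1 * f p.2) (A * A) := fun f hf h =>
      h.mul h (h.summable.mul_of_nonneg h.summable hf hf)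
    exact h0 _ (fun n => by positivity) hA
  have hsum : Summable G := Summable.of_nonneg_of_le hG0
    (fun p => (le_add_of_nonneg_right (hG0 p.swap)).trans (hGs p).le) hprod.summable
  have hsw : HasSum (fun p : ℕ × ℕ => G p.swap) (∑' p, G p) :=
    (Equiv.prodComm ℕ ℕ).hasSum_iff.2 hsum.hasSum
  have hT : ∑' p, G p = A ^ 2 / 2 := by
    have := (hsum.hasSum.add hsw).unique (hprod.congr_fun fun p => hGs p)
    nlinarith
  rw [← hT]
  refine hsum.hasSum.prod_fiberwise fun m => ?_
  refine ((hh m).div_const (((m : ℝ) + s) ^ 3)).congr_fun fun k => ?_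
  have h1 : (m : ℝ) + s ≠ 0 := by positivity
  have h2 : (k : ℝ) + s ≠ 0 := by positivity
  have h3 : (m : ℝ) + k + 2 * s ≠ 0 := by positivity
  have h4 : (k : ℝ) + m + 2 * s ≠ 0 := by positivity
  simp only [hG]
  field_simp
  ring

theorem hasSum_telescope {f : ℕ → ℝ} (hf : Antitone f) (h0 : Tendsto f atTop (𝓝 0)) :
    HasSum (fun k => f k - f (k + 1)) (f 0) := by
  rw [hasSum_iff_tendsto_nat_of_nonneg (fun k => sub_nonneg.2 (hf k.le_succ))]
  simp only [Finset.sum_range_sub']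
  simpa using h0.const_sub (f 0)

theorem hasSum_sub_one_div_of_base {s c : ℝ} (hs : 0 < s)
    (h0 : HasSum (fun k : ℕ => 1 / ((k : ℝ) + s) - 1 / (k + 2 * s)) c) (m : ℕ) :
    HasSum (fun k : ℕ => 1 / ((k : ℝ) + s) - 1 / (k + m + 2 * s))
      (c + ∑ j ∈ Finset.range m, 1 / ((j : ℝ) + 2 * s)) := by
  induction m with
  | zero => simpa using h0
  | succ m ih =>
    have ht : HasSum (fun k : ℕ => 1 / ((k : ℝ) + m + 2 * s) - 1 / (((k + 1 : ℕ) : ℝ) + m + 2 * s))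
        (1 / (((0 : ℕ) : ℝ) + m + 2 * s)) := by
      refine hasSum_telescope (f := fun k : ℕ => 1 / ((k : ℝ) + m + 2 * s)) ?_ ?_
      · intro a b hab
        have : (a : ℝ) ≤ b := by exact_mod_cast hab
        exact one_div_le_one_div_of_le (by positivity) (by linarith)
      · simp only [one_div, add_assoc]
        exact (tendsto_natCast_atTop_atTop.atTop_add tendsto_const_nhds).inv_tendsto_atTop
    rw [Finset.sum_range_succ, ← add_assoc]
    have := ih.add ht
    simp only [Nat.cast_zero, zero_add] at this
    refine this.congr_fun fun k => ?_
    push_cast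
    ring_nf

theorem hasSum_one_div_odd_sub_even :
    HasSum (fun k : ℕ => 1 / ((k : ℝ) + 1 / 2) - 1 / (k + 2 * (1 / 2))) (2 * log 2) := by
  have hint : ∀ n : ℕ, IntegrableOn (fun x : ℝ => x ^ (2 * n) * (1 - x)) (Ioo 0 1) := fun n =>
    (Continuous.integrableOn_Icc (by fun_prop)).mono_set Ioo_subset_Icc_self
  have hval : ∀ n : ℕ, ∫ x in Ioo (0 : ℝ) 1, x ^ (2 * n) * (1 - x) =
      1 / (2 * (n : ℝ) + 1) - 1 / (2 * n + 2) := by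
    intro n
    rw [← integral_Ioc_eq_integral_Ioo, ← intervalIntegral.integral_of_le zero_le_one]
    simp only [mul_sub, mul_one, ← pow_succ]
    rw [intervalIntegral.integral_sub (by apply Continuous.intervalIntegrable; fun_prop)
      (by apply Continuous.intervalIntegrable; fun_prop), integral_pow, integral_pow]
    push_cast
    simp
    ring
  have hnorm : ∀ n : ℕ, ∫ x in Ioo (0 : ℝ) 1, ‖x ^ (2 * n) * (1 - x)‖ ≤
      1 / ((n : ℝ) + 1) ^ 2 := by
    intro n
    rw [setIntegral_congr_fun (g := fun x : ℝ => x ^ (2 * n) * (1 - x)) measurableSet_Ioo, hval]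
    · rw [div_sub_div _ _ (by positivity) (by positivity), div_le_div_iff₀ (by positivity)
        (by positivity)]
      nlinarith [n.cast_nonneg (α := ℝ)]
    · intro x hx
      have : 0 ≤ x ^ (2 * n) * (1 - x) := mul_nonneg (pow_nonneg hx.1.le _) (by linarith [hx.2])
      exact norm_of_nonneg this
  have h := (integrable_and_hasSum_integral measurableSet_Ioo hint hnorm
    hasSum_one_div_succ_sq.summable (F := fun x => 1 / (1 + x)) (fun x hx => ?_)).2
  · have hl : ∫ x in Ioo (0 : ℝ) 1, 1 / (1 + x) = log 2 := by
      rw [← integral_Ioc_eq_integral_Ioo, ← intervalIntegral.integral_of_le zero_le_one,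
        intervalIntegral.integral_comp_add_left (fun x => 1 / x), integral_one_div_of_pos] <;>
      norm_num
    rw [hl] at h
    refine (h.mul_left 2).congr_fun fun n => ?_
    rw [hval]
    field_simp
  · have hg := (hasSum_geometric_of_lt_one (sq_nonneg x)
      (by nlinarith [hx.1, hx.2] : x ^ 2 < 1)).mul_right (1 - x)
    have e : (1 - x ^ 2)⁻¹ * (1 - x) = 1 / (1 + x) := by
      have h1 : 1 - x ≠ 0 := by linarith [hx.2]
      have h2 : 1 + x ≠ 0 := by linarith [hx.1]
      rw [show 1 - x ^ 2 = (1 - x) * (1 + x) by ring]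
      field_simp
    rw [e] at hg
    simpa [pow_mul] using hg

/-- The partial sums `∑_{j < n} 1 / (j + 1)` of the harmonic series. -/
noncomputable def harm (n : ℕ) : ℝ := ∑ j ∈ Finset.range n, 1 / ((j : ℝ) + 1)

theorem harm_succ (n : ℕ) : harm (n + 1) = harm n + 1 / ((n : ℝ) + 1) := Finset.sum_range_succ _ _

theorem harm_nonneg (n : ℕ) : 0 ≤ harm n := Finset.sum_nonneg fun j _ => by positivity

theorem harm_le (n : ℕ) : harm n ≤ n := by
  induction n with
  | zero => simp [harm]
  | succ n ih =>
    rw [harm_succ]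
    have : 1 / ((n : ℝ) + 1) ≤ 1 := by
      rw [div_le_one (by positivity)]; linarith [n.cast_nonneg (α := ℝ)]
    push_cast
    linarith

theorem hasSum_harm_div_succ_cube :
    HasSum (fun n : ℕ => harm n / ((n : ℝ) + 1) ^ 3) (π ^ 4 / 360) := by
  have hbase : HasSum (fun k : ℕ => 1 / ((k : ℝ) + 1) - 1 / (k + 2 * 1)) 1 := by
    have := hasSum_telescope (f := fun k : ℕ => 1 / ((k : ℝ) + 1)) ?_
      tendsto_one_div_add_atTop_nhds_zero_nat
    · simp only [Nat.cast_zero, zero_add, div_one] at this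
      refine this.congr_fun fun k => ?_
      push_cast
      ring_nf
    · intro a b hab
      have : (a : ℝ) ≤ b := by exact_mod_cast hab
      exact one_div_le_one_div_of_le (by positivity) (by linarith)
  have h := hasSum_shuffle one_pos hasSum_one_div_succ_sq (hasSum_sub_one_div_of_base one_pos hbase)
  have h2 := h.sub hasSum_one_div_succ_pow_four
  rw [show (π ^ 2 / 6) ^ 2 / 2 - π ^ 4 / 90 = π ^ 4 / 360 by ring] at h2
  refine h2.congr_fun fun n => ?_
  have e : 1 + ∑ j ∈ Finset.range n, 1 / ((j : ℝ) + 2 * 1) = harm (n + 1) := by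
    rw [harm, Finset.sum_range_succ']
    push_cast
    rw [add_comm]
    congr 1
    · refine Finset.sum_congr rfl fun j _ => ?_
      ring_nf
    · norm_num
  rw [e, harm_succ]
  field_simp
  ring

theorem hasSum_harm_div_odd_cube {Z : ℝ} (hZ : HasSum (fun n : ℕ => 1 / ((n : ℝ) + 1) ^ 3) Z) :
    HasSum (fun n : ℕ => harm n / (2 * (n : ℝ) + 1) ^ 3) (π ^ 4 / 64 - 7 / 4 * log 2 * Z) := by
  have hA : HasSum (fun m : ℕ => 1 / ((m : ℝ) + 1 / 2) ^ 2) (π ^ 2 / 2) := by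
    have := ((hasSum_one_div_odd_pow hasSum_one_div_succ_sq).1).mul_left 4
    rw [show 4 * (π ^ 2 / 6 - π ^ 2 / 6 / 2 ^ 2) = π ^ 2 / 2 by ring] at this
    refine this.congr_fun fun n => ?_
    field_simp
    ring
  have h := hasSum_shuffle one_half_pos hA
    (hasSum_sub_one_div_of_base one_half_pos hasSum_one_div_odd_sub_even)
  have h2 := (h.div_const 8).sub (((hasSum_one_div_odd_pow hZ).1).mul_left (2 * log 2))
  rw [show (π ^ 2 / 2) ^ 2 / 2 / 8 - 2 * log 2 * (Z - Z / 2 ^ 3) =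
    π ^ 4 / 64 - 7 / 4 * log 2 * Z by ring] at h2
  refine h2.congr_fun fun n => ?_
  simp only [mul_one_div_cancel (two_ne_zero (α := ℝ))]
  change _ = (2 * log 2 + harm n) / ((n : ℝ) + 1 / 2) ^ 3 / 8 - _
  have : (n : ℝ) + 1 / 2 ≠ 0 := by positivity
  have h3 : 2 * (n : ℝ) + 1 ≠ 0 := by positivity
  rw [show (n : ℝ) + 1 / 2 = (2 * n + 1) / 2 by ring]
  field_simp
  ring

theorem hasSum_harm_mul_pow {y : ℝ} (h0 : 0 < y) (h1 : y < 1) :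
    HasSum (fun n : ℕ => harm n * y ^ n) (-log (1 - y) / (1 - y)) := by
  have hs : Summable (fun n : ℕ => harm n * y ^ n) := by
    refine Summable.of_nonneg_of_le (fun n => mul_nonneg (harm_nonneg n) (by positivity))
      (fun n => mul_le_mul_of_nonneg_right (harm_le n) (by positivity)) ?_
    simpa using summable_pow_mul_geometric_of_norm_lt_one 1 (r := y) (by
      rwa [norm_eq_abs, abs_of_pos h0])
  set T := ∑' n : ℕ, harm n * y ^ n with hT
  have h2 : HasSum (fun n : ℕ => harm (n + 1) * y ^ (n + 1)) T := by
    have := (hasSum_nat_add_iff' 1).2 hs.hasSum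
    simpa [harm, hT] using this
  have h3 := h2.sub (hs.hasSum.mul_right y)
  have h4 := hasSum_pow_div_log_of_abs_lt_one (x := y) (by rwa [abs_of_pos h0])
  have h5 : -log (1 - y) = T - T * y := h4.unique <| h3.congr_fun fun n => by
    rw [harm_succ]; ring
  have : -log (1 - y) / (1 - y) = T := by
    rw [h5, div_eq_iff (by linarith)]; ring
  rw [this]
  exact hs.hasSum

theorem integrable_and_hasSum_mul_log_pow (k : ℕ) {a : ℕ → ℝ} {e : ℕ → ℕ} {g : ℝ → ℝ}
    (hg : ∀ x ∈ Ioo (0 : ℝ) 1, HasSum (fun n => a n * x ^ e n) (g x))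
    (hs : Summable fun n => |a n| * (k.factorial / ((e n : ℝ) + 1) ^ (k + 1))) :
    IntegrableOn (fun x => g x * log x ^ k) (Ioo 0 1) ∧
      HasSum (fun n => a n * ((-1) ^ k * k.factorial / ((e n : ℝ) + 1) ^ (k + 1)))
        (∫ x in Ioo (0 : ℝ) 1, g x * log x ^ k) := by
  have h := integrable_and_hasSum_integral (μ := volume) (measurableSet_Ioo (a := (0 : ℝ)) (b := 1))
    (f := fun n x => a n * (x ^ e n * log x ^ k)) (F := fun x => g x * log x ^ k)
    (fun n => (integrableOn_pow_mul_log_pow (e n) k).const_mul (a n)) (fun n => ?_) hs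
    (fun x hx => ?_)
  · simpa only [integral_const_mul, integral_pow_mul_log_pow] using h
  · have : ∀ x ∈ Ioo (0 : ℝ) 1, ‖a n * (x ^ e n * log x ^ k)‖ =
        |a n| * (-1) ^ k * (x ^ e n * log x ^ k) := by
      intro x hx
      rw [norm_mul, norm_mul, norm_pow, norm_pow, norm_eq_abs, norm_eq_abs, norm_eq_abs,
        abs_of_pos hx.1, abs_of_neg (log_neg hx.1 hx.2), neg_pow]
      ring
    rw [setIntegral_congr_fun measurableSet_Ioo this, integral_const_mul,
      integral_pow_mul_log_pow]
    refine le_of_eq ?_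
    rw [mul_assoc, mul_div_assoc, ← mul_assoc ((-1 : ℝ) ^ k), ← mul_pow]
    norm_num
  · refine ((hg x hx).mul_right (log x ^ k)).congr_fun fun n => ?_
    ring

theorem integral_log_sub_log_div :
    IntegrableOn (fun z => (log (1 + z) - log (1 - z)) / z * log z ^ 2) (Ioo 0 1) ∧
      ∫ z in Ioo (0 : ℝ) 1, (log (1 + z) - log (1 - z)) / z * log z ^ 2 = π ^ 4 / 24 := by
  have hv := ((hasSum_one_div_odd_pow hasSum_one_div_succ_pow_four).1).mul_left 4
  rw [show 4 * (π ^ 4 / 90 - π ^ 4 / 90 / 2 ^ 4) = π ^ 4 / 24 by ring] at hv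
  have h := integrable_and_hasSum_mul_log_pow 2 (a := fun n => 2 * (1 / (2 * (n : ℝ) + 1)))
    (e := fun n => 2 * n) (g := fun z => (log (1 + z) - log (1 - z)) / z) (fun x hx => ?_)
    (hv.summable.congr fun n => ?_)
  · refine ⟨h.1, h.2.unique (hv.congr_fun fun n => ?_)⟩
    push_cast
    field_simp
    norm_num
  · have h1 := (hasSum_log_sub_log_of_abs_lt_one (x := x)
      (abs_lt.2 ⟨by linarith [hx.1], hx.2⟩)).div_const x
    refine h1.congr_fun fun n => ?_
    have := hx.1.ne'
    rw [pow_succ]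
    field_simp
  · rw [abs_of_nonneg (by positivity)]
    push_cast
    field_simp
    norm_num

theorem integral_log_one_sub_sq_div {Z : ℝ}
    (hZ : HasSum (fun n : ℕ => 1 / ((n : ℝ) + 1) ^ 3) Z) :
    IntegrableOn (fun z => -log (1 - z ^ 2) / (1 - z ^ 2) * log z ^ 2) (Ioo 0 1) ∧
      ∫ z in Ioo (0 : ℝ) 1, -log (1 - z ^ 2) / (1 - z ^ 2) * log z ^ 2 =
        2 * (π ^ 4 / 64 - 7 / 4 * log 2 * Z) := by
  have hv := (hasSum_harm_div_odd_cube hZ).mul_left 2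
  have h := integrable_and_hasSum_mul_log_pow 2 (a := harm)
    (e := fun n => 2 * n) (g := fun z => -log (1 - z ^ 2) / (1 - z ^ 2)) (fun x hx => ?_)
    (hv.summable.congr fun n => ?_)
  · refine ⟨h.1, h.2.unique (hv.congr_fun fun n => ?_)⟩
    push_cast
    norm_num
    ring
  · have h1 := hasSum_harm_mul_pow (y := x ^ 2) (pow_pos hx.1 2) (by nlinarith [hx.1, hx.2])
    simpa only [pow_mul] using h1
  · rw [abs_of_nonneg (harm_nonneg n)]
    push_cast
    norm_num
    ring

theorem integral_log_one_sub_div :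
    IntegrableOn (fun z => -log (1 - z) / (1 - z) * log z ^ 2) (Ioo 0 1) ∧
      ∫ z in Ioo (0 : ℝ) 1, -log (1 - z) / (1 - z) * log z ^ 2 = π ^ 4 / 180 := by
  have hv := hasSum_harm_div_succ_cube.mul_left 2
  rw [show 2 * (π ^ 4 / 360) = π ^ 4 / 180 by ring] at hv
  have h := integrable_and_hasSum_mul_log_pow 2 (a := harm)
    (e := fun n => n) (g := fun z => -log (1 - z) / (1 - z)) (fun x hx => ?_)
    (hv.summable.congr fun n => ?_)
  · refine ⟨h.1, h.2.unique (hv.congr_fun fun n => ?_)⟩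
    norm_num
    ring
  · exact hasSum_harm_mul_pow hx.1 hx.2
  · rw [abs_of_nonneg (harm_nonneg n)]
    norm_num
    ring

theorem integral_log_pow_div_one_add {k : ℕ} {A : ℝ}
    (hA : HasSum (fun n : ℕ => 1 / ((n : ℝ) + 1) ^ (k + 1)) A) :
    IntegrableOn (fun z => 1 / (1 + z) * log z ^ k) (Ioo 0 1) ∧
      ∫ z in Ioo (0 : ℝ) 1, 1 / (1 + z) * log z ^ k =
        (-1) ^ k * k.factorial * (A - 2 * (A / 2 ^ (k + 1))) := by
  have hv := ((hasSum_one_div_odd_pow hA).2).mul_left ((-1 : ℝ) ^ k * k.factorial)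
  have h := integrable_and_hasSum_mul_log_pow k (a := fun n => (-1) ^ n)
    (e := fun n => n) (g := fun z => 1 / (1 + z)) (fun x hx => ?_)
    ((hA.mul_left (k.factorial : ℝ)).summable.congr fun n => ?_)
  · refine ⟨h.1, h.2.unique (hv.congr_fun fun n => ?_)⟩
    ring
  · have h1 := hasSum_geometric_of_abs_lt_one (r := -x)
      (by rw [abs_neg, abs_of_pos hx.1]; exact hx.2)
    rw [sub_neg_eq_add, ← one_div] at h1
    refine h1.congr_fun fun n => ?_
    rw [← neg_pow]
  · simp [div_eq_mul_inv]

theorem rpolylog_four_half :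
    HasSum (fun n : ℕ => (1 / 2 : ℝ) ^ (n + 1) / ((n : ℝ) + 1) ^ 4) (rpolylog 4 (1 / 2)) := by
  have hs : Summable (fun n : ℕ => (1 / 2 : ℝ) ^ (n + 1) / ((n : ℝ) + 1) ^ 4) := by
    refine (summable_one_div_succ_pow (k := 4) (by norm_num)).of_nonneg_of_le
      (fun n => by positivity) (fun n => ?_)
    gcongr
    exact pow_le_one₀ (by norm_num) (by norm_num)
  have := hs.hasSum
  simpa [rpolylog] using this

theorem integral_log_cube_div_two_sub :
    ∫ x in Ioo (0 : ℝ) 1, 1 / (2 - x) * log x ^ 3 = -6 * rpolylog 4 (1 / 2) := by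
  have hv := rpolylog_four_half.mul_left (-6)
  have h := integrable_and_hasSum_mul_log_pow 3 (a := fun n => (1 / 2) ^ (n + 1))
    (e := fun n => n) (g := fun x => 1 / (2 - x)) (fun x hx => ?_)
    ((rpolylog_four_half.mul_left 6).summable.congr fun n => ?_)
  · refine h.2.unique (hv.congr_fun fun n => ?_)
    norm_num [Nat.factorial]
    ring
  · have h1 := (hasSum_geometric_of_lt_one (r := x / 2) (by linarith [hx.1])
      (by linarith [hx.2])).mul_left (1 / 2)
    have e : 1 / 2 * (1 - x / 2)⁻¹ = 1 / (2 - x) := by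
      have : 2 - x ≠ 0 := by linarith [hx.2]
      rw [show 1 - x / 2 = (2 - x) / 2 by ring]
      field_simp
    rw [e] at h1
    refine h1.congr_fun fun n => ?_
    rw [div_pow, pow_succ, div_pow]
    ring
  · rw [abs_of_nonneg (by positivity)]
    norm_num [Nat.factorial]
    ring

theorem hasDerivAt_log_one_add_sub {x : ℝ} (hx : 0 ≤ x) (c : ℝ) :
    HasDerivAt (fun z => log (1 + z) - c) (1 / (1 + x)) x := by
  have := (((hasDerivAt_id x).const_add 1).log (by simp; linarith)).sub_const c
  simpa using this

theorem continuousOn_log_one_add_sub (c : ℝ) :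
    ContinuousOn (fun z => log (1 + z) - c) (Icc 0 1) :=
  fun _ hx => (hasDerivAt_log_one_add_sub hx.1 c).continuousAt.continuousWithinAt

theorem continuousOn_log_half_pow_mul (k n : ℕ) :
    ContinuousOn (fun z => (log (1 + z) - log 2) ^ k * (1 / (1 + z) ^ n)) (Icc 0 1) :=
  ((continuousOn_log_one_add_sub (log 2)).pow k).mul
    (continuousOn_const.div (by fun_prop) fun x hx => (pow_pos (by linarith [hx.1]) n).ne')

theorem hasIntegralOn_log_half_pow_div (k : ℕ) :
    HasIntegralOn (fun z => (log (1 + z) - log 2) ^ k * (1 / (1 + z))) (Ioo 0 1)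
      (-((-log 2) ^ (k + 1) / (k + 1))) := by
  have h := hasIntegralOn_Ioo_of_hasDerivAt_Icc zero_le_one
    (f := fun z => (log (1 + z) - log 2) ^ (k + 1) / (k + 1))
    (f' := fun z => (log (1 + z) - log 2) ^ k * (1 / (1 + z))) (fun x hx => ?_) ?_
  · refine h.of_eq ?_
    norm_num
  · refine (((hasDerivAt_log_one_add_sub hx.1 (log 2)).pow (k + 1)).div_const
      ((k : ℝ) + 1)).congr_deriv ?_
    push_cast
    field_simp
  · simpa using continuousOn_log_half_pow_mul k 1

theorem hasIntegralOn_log_half_sq_div_pow (n : ℕ) :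
    HasIntegralOn (fun z => (log (1 + z) - log 2) ^ 2 * (1 / (1 + z) ^ (n + 2))) (Ioo 0 1)
      (log 2 ^ 2 / (n + 1) - 2 * log 2 / (n + 1) ^ 2 + 2 / (n + 1) ^ 3
        - 2 * (1 / 2) ^ (n + 1) / (n + 1) ^ 3) := by
  have h := hasIntegralOn_Ioo_of_hasDerivAt_Icc zero_le_one
    (f := fun z => 1 / (1 + z) ^ (n + 1) * (-(log (1 + z) - log 2) ^ 2 / (n + 1)
      - 2 * (log (1 + z) - log 2) / (n + 1) ^ 2 - 2 / (n + 1) ^ 3))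
    (f' := fun z => (log (1 + z) - log 2) ^ 2 * (1 / (1 + z) ^ (n + 2))) (fun x hx => ?_) ?_
  · refine h.of_eq ?_
    simp only [one_div_pow]
    norm_num
    ring
  · have h1 : 1 + x ≠ 0 := by linarith [hx.1]
    have hb := hasDerivAt_log_one_add_sub hx.1 (log 2)
    have hp : HasDerivAt (fun z : ℝ => 1 / (1 + z) ^ (n + 1)) (-(n + 1) / (1 + x) ^ (n + 2)) x := by
      have := (((hasDerivAt_id x).const_add 1).pow (n + 1)).inv (pow_ne_zero _ h1)
      simp only [id, ← one_div] at this
      refine this.congr_deriv ?_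
      simp
      field_simp
      ring
    have h := hp.mul ((((hb.pow 2).neg.div_const ((n : ℝ) + 1)).sub
      ((hb.const_mul 2).div_const (((n : ℝ) + 1) ^ 2))).sub_const (2 / ((n : ℝ) + 1) ^ 3))
    refine h.congr_deriv ?_
    simp
    field_simp
    ring
  · exact continuousOn_log_half_pow_mul 2 (n + 2)

theorem integral_log_mul_log_half_sq_div {Z : ℝ}
    (hZ : HasSum (fun n : ℕ => 1 / ((n : ℝ) + 1) ^ 3) Z) :
    HasIntegralOn (fun z => log z * (log (1 + z) - log 2) ^ 2 * (1 / (1 + z))) (Ioo 0 1)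
      (-(π ^ 2 * log 2 ^ 2 / 6) + 2 * log 2 * Z - π ^ 4 / 45 + 2 * rpolylog 4 (1 / 2)
          + log 2 ^ 4 / 12) := by
  have hv := (((hasSum_one_div_succ_sq.mul_left (log 2 ^ 2)).sub (hZ.mul_left (2 * log 2))).add
    (hasSum_one_div_succ_pow_four.mul_left 2)).sub (rpolylog_four_half.mul_left 2)
  have hterm : ∀ n : ℕ, HasIntegralOn (fun z =>
      1 / ((n : ℝ) + 1) * ((log (1 + z) - log 2) ^ 2 * (1 / (1 + z) ^ (n + 2)))) (Ioo 0 1)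
      (log 2 ^ 2 * (1 / ((n : ℝ) + 1) ^ 2) - 2 * log 2 * (1 / ((n : ℝ) + 1) ^ 3) +
      2 * (1 / ((n : ℝ) + 1) ^ 4) - 2 * ((1 / 2) ^ (n + 1) / ((n : ℝ) + 1) ^ 4)) := by
    intro n
    refine ((hasIntegralOn_log_half_sq_div_pow n).const_mul _).of_eq ?_
    field_simp
  have h := integrable_and_hasSum_integral (μ := volume) (measurableSet_Ioo (a := (0 : ℝ)) (b := 1))
    (f := fun (n : ℕ) z => 1 / ((n : ℝ) + 1) *
      ((log (1 + z) - log 2) ^ 2 * (1 / (1 + z) ^ (n + 2))))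
    (F := fun z => -(log z - log (1 + z)) * (log (1 + z) - log 2) ^ 2 * (1 / (1 + z)))
    (fun n => (hterm n).1)
    (fun n => le_of_eq ?_) hv.summable (fun x hx => ?_)
  · simp only [fun n => (hterm n).2] at h
    have hN : HasIntegralOn _ _ _ := ⟨h.1, h.2.unique hv⟩
    refine (((hasIntegralOn_log_half_pow_div 3).add
      ((hasIntegralOn_log_half_pow_div 2).const_mul (log 2))).sub hN).congr measurableSet_Ioo
      (fun z _ => by ring) ?_
    push_cast
    ring
  · rw [← (hterm n).2]
    refine setIntegral_congr_fun measurableSet_Ioo fun x hx => norm_of_nonneg ?_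
    have := hx.1
    positivity
  · have h0 := hx.1
    have h1 : 1 + x ≠ 0 := by positivity
    have hl := hasSum_pow_div_log_of_abs_lt_one (x := 1 / (1 + x)) (by
      rw [abs_of_pos (by positivity), div_lt_one (by positivity)]; linarith)
    rw [show 1 - 1 / (1 + x) = x / (1 + x) by field_simp; ring, log_div h0.ne' h1] at hl
    refine ((hl.mul_right ((log (1 + x) - log 2) ^ 2)).mul_right (1 / (1 + x))).congr_fun
      fun n => ?_
    rw [one_div_pow]
    field_simp
    ring

theorem integral_log_two_mul_div_cube :
    ∫ z in Ioo (0 : ℝ) 1, (log z - (log (1 + z) - log 2)) ^ 3 * (1 / (1 + z)) =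
      -6 * rpolylog 4 (1 / 2) := by
  have himg : (fun z : ℝ => 2 * z / (1 + z)) '' Ioo 0 1 = Ioo 0 1 := by
    ext y
    simp only [mem_image, mem_Ioo]
    constructor
    · rintro ⟨z, ⟨h0, h1⟩, rfl⟩
      exact ⟨by positivity, by rw [div_lt_one (by positivity)]; linarith⟩
    · rintro ⟨h0, h1⟩
      have : 2 - y ≠ 0 := by linarith
      refine ⟨y / (2 - y), ⟨div_pos h0 (by linarith), by rw [div_lt_one (by linarith)]; linarith⟩,
        ?_⟩
      field_simp
      ring
  rw [← integral_log_cube_div_two_sub]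
  conv_rhs => rw [← himg]
  rw [integral_image_eq_integral_abs_deriv_smul (f' := fun z => 2 / (1 + z) ^ 2) measurableSet_Ioo]
  · refine setIntegral_congr_fun measurableSet_Ioo fun z hz => ?_
    have h0 := hz.1
    have h1 : 1 + z ≠ 0 := by positivity
    rw [abs_of_pos (by positivity), log_div (by positivity) h1, log_mul two_ne_zero h0.ne',
      smul_eq_mul, show 2 - 2 * z / (1 + z) = 2 / (1 + z) by field_simp; ring]
    field_simp
    ring
  · intro z hz
    have h1 : 1 + z ≠ 0 := by linarith [hz.1]
    have := ((hasDerivAt_id z).const_mul 2).div ((hasDerivAt_id z).const_add 1) h1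
    refine (this.congr_deriv ?_).hasDerivWithinAt
    simp
    ring
  · intro a ha b hb h
    have h1 : 1 + a ≠ 0 := by linarith [ha.1]
    have h2 : 1 + b ≠ 0 := by linarith [hb.1]
    simp only at h
    rw [div_eq_div_iff h1 h2] at h
    linarith

theorem integral_log_sq_mul_log_half_div {Z : ℝ}
    (hZ : HasSum (fun n : ℕ => 1 / ((n : ℝ) + 1) ^ 3) Z) :
    HasIntegralOn (fun z => log z ^ 2 * (log (1 + z) - log 2) * (1 / (1 + z))) (Ioo 0 1)
      (4 * rpolylog 4 (1 / 2) - 7 * π ^ 4 / 360 - π ^ 4 / 45 - π ^ 2 * log 2 ^ 2 / 6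
          + 2 * log 2 * Z + log 2 ^ 4 / 6) := by
  have hN := integral_log_mul_log_half_sq_div hZ
  have h3 : HasIntegralOn _ _ _ :=
    integral_log_pow_div_one_add (k := 3) hasSum_one_div_succ_pow_four
  have h2 := integral_log_pow_div_one_add (k := 2) hZ
  have hb := hasIntegralOn_log_half_pow_div 3
  have hi : IntegrableOn (fun z => log z ^ 2 * (log (1 + z) - log 2) * (1 / (1 + z)))
      (Ioo 0 1) := by
    have hm : AEStronglyMeasurable (fun z : ℝ => log (1 + z) - log 2)
        (volume.restrict (Ioo 0 1)) :=
      (integrableOn_Ioo_of_continuousOn_Icc (continuousOn_log_one_add_sub (log 2))).1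
    have := h2.1.bdd_mul (c := log 2) hm ((ae_restrict_iff' measurableSet_Ioo).2
      (Eventually.of_forall fun z hz => ?_))
    · refine this.congr (Eventually.of_forall fun z => ?_)
      ring
    · have h0 : 0 ≤ log (1 + z) := log_nonneg (by linarith [hz.1])
      have h1 : log (1 + z) ≤ log 2 := log_le_log (by linarith [hz.1]) (by linarith [hz.2])
      rw [norm_eq_abs, abs_le]
      constructor <;> linarith
  have h := ((h3.sub ((hasIntegralOn_self hi).const_mul 3)).add (hN.const_mul 3)).sub hb
  refine ⟨hi, ?_⟩
  have hq := integral_log_two_mul_div_cube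
  have hF := (h.congr (g := fun z => (log z - (log (1 + z) - log 2)) ^ 3 * (1 / (1 + z)))
    measurableSet_Ioo (fun z _ => by ring) rfl).2.symm.trans hq
  norm_num [Nat.factorial] at hF
  simp only [one_div]
  linarith

theorem integral_log_sq_mul_log_div :
    HasIntegralOn (fun z => log z ^ 2 * (log (1 - z) - log (1 + z)) *
      ((z ^ 2 + 1) / (z * (z ^ 2 - 1)))) (Ioo 0 1)
      (-8 * rpolylog 4 (1 / 2) - log 2 ^ 4 / 3 + π ^ 2 * log 2 ^ 2 / 3 + 53 * π ^ 4 / 720) := by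
  obtain ⟨Z, hZ⟩ := summable_one_div_succ_pow (k := 3) (by norm_num)
  have h1 : HasIntegralOn _ _ _ := integral_log_sub_log_div
  have h2 : HasIntegralOn _ _ _ := integral_log_one_sub_sq_div hZ
  have h3 : HasIntegralOn _ _ _ := integral_log_one_sub_div
  have h4 := integral_log_sq_mul_log_half_div hZ
  have h5 : HasIntegralOn _ _ _ := integral_log_pow_div_one_add (k := 2) hZ
  refine ((((h1.sub (h2.const_mul 2)).add (h3.const_mul 2)).sub (h4.const_mul 2)).sub
    (h5.const_mul (2 * log 2))).congr measurableSet_Ioo (fun z hz => ?_) ?_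
  · have a0 : z ≠ 0 := hz.1.ne'
    have a1 : 1 - z ≠ 0 := by linarith [hz.2]
    have a2 : 1 + z ≠ 0 := by linarith [hz.1]
    have e : (1 - z ^ 2) = (1 - z) * (1 + z) := by ring
    have e' : (z ^ 2 - 1) = -((1 - z) * (1 + z)) := by ring
    rw [e, e', log_mul a1 a2]
    field_simp
    ring
  · norm_num [Nat.factorial]
    ring

theorem integrableOn_Ioi_of_norm_le_exp {E : Type*} [NormedAddCommGroup E] {f : ℝ → E}
    (hc : ContinuousOn f (Ici 0)) {C R : ℝ} (hb : ∀ s, R ≤ s → ‖f s‖ ≤ C * exp (-s / 2)) :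
    IntegrableOn f (Ioi 0) := by
  have hm : AEStronglyMeasurable f (volume.restrict (Ioi 0)) :=
    (hc.mono Ioi_subset_Ici_self).aestronglyMeasurable measurableSet_Ioi
  refine (integrable_norm_iff hm).1 ?_
  refine integrable_of_isBigO_exp_neg (b := 1 / 2) (by norm_num) hc.norm ?_
  refine Asymptotics.IsBigO.of_bound C ?_
  filter_upwards [eventually_ge_atTop R] with s hs
  rw [norm_norm, norm_of_nonneg (exp_pos _).le]
  convert hb s hs using 3
  ring

/-- Cauchy's theorem on the half-strip `re w < 0`, `0 < im w < c`. -/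
theorem integral_boundary_halfStrip {F : ℂ → ℂ} {c C R : ℝ} (hc : 0 < c)
    (hF : ContinuousOn F (Iic 0 ×ℂ Icc 0 c)) (hd : DifferentiableOn ℂ F (Iio 0 ×ℂ Ioo 0 c))
    (hb : ∀ s, R ≤ s → ∀ y ∈ Icc 0 c, ‖F (-s + y * Complex.I)‖ ≤ C * exp (-s / 2)) :
    IntegrableOn (fun s : ℝ => F (-s)) (Ioi 0) ∧
    IntegrableOn (fun s : ℝ => F (-s + c * Complex.I)) (Ioi 0) ∧
    IntegrableOn (fun y : ℝ => F (y * Complex.I)) (Ioo 0 c) ∧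
    (∫ s : ℝ in Ioi 0, F (-s)) - (∫ s : ℝ in Ioi 0, F (-s + c * Complex.I)) +
      Complex.I * ∫ y : ℝ in Ioo 0 c, F (y * Complex.I) = 0 := by
  have hline : ∀ y ∈ Icc 0 c, ContinuousOn (fun s : ℝ => F (-s + y * Complex.I)) (Ici 0) := by
    intro y hy
    refine hF.comp (f := fun s : ℝ => (-s + y * Complex.I : ℂ)) (by fun_prop) fun s hs => ?_
    rw [Complex.mem_reProdIm]
    simpa using ⟨hs, hy⟩
  have h0 : IntegrableOn (fun s : ℝ => F (-s)) (Ioi 0) := by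
    have := integrableOn_Ioi_of_norm_le_exp (hline 0 ⟨le_rfl, hc.le⟩)
      (fun s hs => hb s hs 0 ⟨le_rfl, hc.le⟩)
    simpa using this
  have h1 : IntegrableOn (fun s : ℝ => F (-s + c * Complex.I)) (Ioi 0) :=
    integrableOn_Ioi_of_norm_le_exp (hline c ⟨hc.le, le_rfl⟩)
      (fun s hs => hb s hs c ⟨hc.le, le_rfl⟩)
  have h2 : IntegrableOn (fun y : ℝ => F (y * Complex.I)) (Ioo 0 c) := by
    refine integrableOn_Ioo_of_continuousOn_Icc
      (hF.comp (f := fun y : ℝ => (y * Complex.I : ℂ)) (by fun_prop) fun y hy => ?_)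
    rw [Complex.mem_reProdIm]
    simpa using hy
  refine ⟨h0, h1, h2, ?_⟩
  have hrect : ∀ T : ℝ, 0 < T → (∫ s in (0 : ℝ)..T, F (-s)) -
      (∫ s in (0 : ℝ)..T, F (-s + c * Complex.I)) +
      Complex.I * (∫ y in (0 : ℝ)..c, F (y * Complex.I)) =
        Complex.I * ∫ y in (0 : ℝ)..c, F (-T + y * Complex.I) := by
    intro T hT
    have h := Complex.integral_boundary_rect_eq_zero_of_continuousOn_of_differentiableOn F
      (-T : ℂ) (c * Complex.I) (hF.mono ?_) (hd.mono ?_)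
    · have e1 : ∫ x in (-T)..0, F x = ∫ s in (0 : ℝ)..T, F (-s) := by
        have := intervalIntegral.integral_comp_neg (a := 0) (b := T) (fun x : ℝ => F x)
        simpa using this.symm
      have e2 : ∫ x in (-T)..0, F (x + c * Complex.I) =
          ∫ s in (0 : ℝ)..T, F (-s + c * Complex.I) := by
        have := intervalIntegral.integral_comp_neg (a := 0) (b := T)
          (fun x : ℝ => F (x + c * Complex.I))
        simpa using this.symm
      simp at h
      rw [e1, e2] at h
      linear_combination h
    · intro w hw
      rw [Complex.mem_reProdIm] at hw ⊢
      simp [uIcc_of_le hc.le, uIcc_of_le (neg_nonpos.2 hT.le)] at hw ⊢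
      exact ⟨hw.1.2, hw.2⟩
    · intro w hw
      rw [Complex.mem_reProdIm] at hw ⊢
      simp [hc.le, hT.le] at hw ⊢
      exact ⟨hw.1.2, hw.2⟩
  have hz : Tendsto (fun T : ℝ => Complex.I * ∫ y in (0 : ℝ)..c, F (-T + y * Complex.I)) atTop
      (𝓝 0) := by
    have he : Tendsto (fun T : ℝ => C * exp (-T / 2) * |c - 0|) atTop (𝓝 (C * 0 * |c - 0|)) := by
      refine (Tendsto.const_mul C (tendsto_exp_atBot.comp ?_)).mul_const _
      exact (tendsto_neg_atTop_atBot).atBot_div_const two_pos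
    rw [mul_zero, zero_mul] at he
    refine squeeze_zero_norm' ?_ he
    filter_upwards [eventually_ge_atTop R] with T hT
    rw [norm_mul, Complex.norm_I, one_mul]
    refine intervalIntegral.norm_integral_le_of_norm_le_const fun y hy => hb T hT y ?_
    rw [uIoc_of_le hc.le] at hy
    exact ⟨hy.1.le, hy.2⟩
  have hlim : Tendsto (fun T : ℝ => (∫ s in (0 : ℝ)..T, F (-s)) -
      (∫ s in (0 : ℝ)..T, F (-s + c * Complex.I)) +
      Complex.I * (∫ y in (0 : ℝ)..c, F (y * Complex.I))) atTop
      (𝓝 ((∫ s : ℝ in Ioi 0, F (-s)) - (∫ s : ℝ in Ioi 0, F (-s + c * Complex.I)) +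
      Complex.I * (∫ y in (0 : ℝ)..c, F (y * Complex.I)))) :=
    ((intervalIntegral_tendsto_integral_Ioi 0 h0 tendsto_id).sub
      (intervalIntegral_tendsto_integral_Ioi 0 h1 tendsto_id)).add_const _
  have := tendsto_nhds_unique (hlim.congr' ?_) hz
  · rwa [intervalIntegral.integral_of_le hc.le, integral_Ioc_eq_integral_Ioo] at this
  · filter_upwards [eventually_gt_atTop 0] with T hT using hrect T hT

theorem integral_boundary_halfStrip_re {F : ℂ → ℂ} {c C R : ℝ} (hc : 0 < c)
    (hF : ContinuousOn F (Iic 0 ×ℂ Icc 0 c)) (hd : DifferentiableOn ℂ F (Iio 0 ×ℂ Ioo 0 c))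
    (hb : ∀ s, R ≤ s → ∀ y ∈ Icc 0 c, ‖F (-s + y * Complex.I)‖ ≤ C * exp (-s / 2))
    {f g h : ℝ → ℝ} (hf : ∀ s : ℝ, 0 < s → (F (-s)).re = f s)
    (hg : ∀ s : ℝ, 0 < s → (F (-s + c * Complex.I)).re = g s)
    (hh : ∀ y : ℝ, y ∈ Ioo 0 c → (F (y * Complex.I)).im = h y) :
    IntegrableOn f (Ioi 0) ∧ IntegrableOn g (Ioi 0) ∧ IntegrableOn h (Ioo 0 c) ∧
      (∫ s in Ioi 0, f s) - (∫ s in Ioi 0, g s) - ∫ y in Ioo 0 c, h y = 0 := by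
  obtain ⟨h0, h1, h2, h3⟩ := integral_boundary_halfStrip hc hF hd hb
  refine ⟨IntegrableOn.congr_fun (f := fun s : ℝ => (F (-s)).re) h0.re (fun s hs =>
    hf s hs) measurableSet_Ioi,
    IntegrableOn.congr_fun (f := fun s : ℝ => (F (-s + c * Complex.I)).re) h1.re (fun s hs =>
      hg s hs) measurableSet_Ioi,
    IntegrableOn.congr_fun (f := fun y : ℝ => (F (y * Complex.I)).im) h2.im (fun s hs =>
      hh s hs) measurableSet_Ioo, ?_⟩
  have := congrArg Complex.re h3
  simp only [Complex.add_re, Complex.sub_re, Complex.I_mul_re, Complex.zero_re] at this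
  rw [← setIntegral_congr_fun (f := fun s : ℝ => (F (-s)).re) measurableSet_Ioi
      (fun s hs => hf s hs),
    ← setIntegral_congr_fun (f := fun s : ℝ => (F (-s + c * Complex.I)).re) measurableSet_Ioi
      (fun s hs => hg s hs),
    ← setIntegral_congr_fun (f := fun y : ℝ => (F (y * Complex.I)).im) measurableSet_Ioo
      (fun s hs => hh s hs)]
  have e0 := integral_re h0
  have e1 := integral_re h1
  have e2 := integral_im h2
  simp only [RCLike.re_eq_complex_re, RCLike.im_eq_complex_im] at e0 e1 e2
  rw [e0, e1, e2]
  linarith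

theorem integrableOn_comp_exp_neg_iff (G : ℝ → ℝ) :
    IntegrableOn (fun s => G (exp (-s))) (Ioi 0) ↔ IntegrableOn (fun y => G y / y) (Ioo 0 1) := by
  rw [integrableOn_Ioo_zero_one_iff_exp_neg]
  refine integrableOn_congr_fun (fun s _ => ?_) measurableSet_Ioi
  have := (exp_pos (-s)).ne'
  simp only [smul_eq_mul]
  field_simp

theorem integral_comp_exp_neg (G : ℝ → ℝ) :
    ∫ s in Ioi 0, G (exp (-s)) = ∫ y in Ioo 0 1, G y / y := by
  rw [integral_Ioo_zero_one_eq_exp_neg]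
  refine setIntegral_congr_fun measurableSet_Ioi (fun s _ => ?_)
  have := (exp_pos (-s)).ne'
  simp only [smul_eq_mul]
  field_simp

theorem exp_neg_add_pi_div_two_mul_I (s : ℝ) :
    Complex.exp (-s + (π / 2 : ℝ) * Complex.I) = (exp (-s) : ℝ) * Complex.I := by
  rw [Complex.exp_add, Complex.exp_mul_I]
  push_cast
  simp

theorem log_one_add_mul_I (y : ℝ) :
    Complex.log (1 + y * Complex.I) = (log (1 + y ^ 2) / 2 : ℝ) + arctan y * Complex.I := by
  have hn : ‖(1 + y * Complex.I : ℂ)‖ = √(1 + y ^ 2) := by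
    rw [Complex.norm_eq_sqrt_sq_add_sq]
    simp
  apply Complex.ext
  · rw [Complex.log_re, hn, Real.log_sqrt (by positivity)]
    simp [-Complex.ofReal_arctan]
  · rw [Complex.log_im, Complex.arg_of_re_nonneg (by simp), hn]
    simp [-Complex.ofReal_arctan, arctan_eq_arcsin]

theorem log_one_add_exp_mul_I {t : ℝ} (h0 : -π < t) (h1 : t < π) :
    Complex.log (1 + Complex.exp (t * Complex.I)) =
      (log (2 * cos (t / 2)) : ℝ) + (t / 2 : ℝ) * Complex.I := by
  have hc : 0 < cos (t / 2) := cos_pos_of_mem_Ioo ⟨by linarith, by linarith⟩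
  have e : 1 + Complex.exp (t * Complex.I) =
      ((2 * cos (t / 2) : ℝ) : ℂ) * Complex.exp ((t / 2 : ℝ) * Complex.I) := by
    have : Complex.exp (t * Complex.I) = Complex.exp ((t / 2 : ℝ) * Complex.I) ^ 2 := by
      rw [← Complex.exp_nat_mul]; congr 1; push_cast; ring
    rw [this, Complex.exp_mul_I, ← Complex.ofReal_cos, ← Complex.ofReal_sin]
    have h := sin_sq_add_cos_sq (t / 2)
    generalize cos (t / 2) = c at h
    generalize sin (t / 2) = d at h
    apply Complex.ext
    · simp [pow_two]; nlinarith
    · simp [pow_two]; ring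
  rw [e, Complex.log_ofReal_mul (by positivity) (Complex.exp_ne_zero _), Complex.log_exp]
  · simp; linarith
  · simp; linarith

theorem re_exp_nonneg_of_mem_strip {w : ℂ} (hw : w ∈ Iic 0 ×ℂ Icc 0 (π / 2)) :
    0 ≤ (Complex.exp w).re := by
  rw [Complex.mem_reProdIm] at hw
  rw [Complex.exp_re]
  exact mul_nonneg (exp_pos _).le (cos_nonneg_of_mem_Icc ⟨by linarith [hw.2.1, pi_pos], hw.2.2⟩)

theorem norm_exp_neg_add_mul_I (s y : ℝ) : ‖Complex.exp (-s + y * Complex.I)‖ = exp (-s) := by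
  rw [Complex.norm_exp]; simp

theorem exp_neg_le_half {s : ℝ} (hs : 1 ≤ s) : exp (-s) ≤ 1 / 2 := by
  rw [exp_neg, ← one_div]
  exact one_div_le_one_div_of_le two_pos (by linarith [add_one_le_exp s])

theorem mem_strip_of_interior {w : ℂ} {c : ℝ} (hw : w ∈ Iio 0 ×ℂ Ioo 0 c) :
    w ∈ Iic 0 ×ℂ Icc 0 c := by
  rw [Complex.mem_reProdIm] at hw ⊢
  exact ⟨(mem_Iio.1 hw.1).le, hw.2.1.le, hw.2.2.le⟩

theorem integral_log_cos_sq_sub_sq :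
    IntegrableOn (fun y => log (1 + y ^ 2) * arctan y / y) (Ioo 0 1) ∧
    IntegrableOn (fun t => log (2 * cos (t / 2)) ^ 2 - (t / 2) ^ 2) (Ioo 0 (π / 2)) ∧
    ∫ t in Ioo 0 (π / 2), (log (2 * cos (t / 2)) ^ 2 - (t / 2) ^ 2) =
      ∫ y in Ioo (0 : ℝ) 1, log (1 + y ^ 2) * arctan y / y := by
  have hslit : ∀ w ∈ Iic 0 ×ℂ Icc 0 (π / 2), 1 + Complex.exp w ∈ Complex.slitPlane := by
    intro w hw
    left
    have := re_exp_nonneg_of_mem_strip hw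
    simp
    linarith
  have hdiff : ∀ w ∈ Iic 0 ×ℂ Icc 0 (π / 2),
      DifferentiableAt ℂ (fun w => Complex.I * Complex.log (1 + Complex.exp w) ^ 2) w := fun w hw =>
    (((Complex.differentiableAt_exp.const_add 1).clog (hslit w hw)).pow 2).const_mul _
  have hb : ∀ s : ℝ, 2 ≤ s → ∀ y ∈ Icc 0 (π / 2),
      ‖Complex.I * Complex.log (1 + Complex.exp (-s + (y : ℝ) * Complex.I)) ^ 2‖ ≤ 1 *
        exp (-s / 2) := by
    intro s hs y hy
    have hl := Complex.norm_log_one_add_half_le_self (z := Complex.exp (-s + y * Complex.I))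
      (by rw [norm_exp_neg_add_mul_I]; exact exp_neg_le_half (by linarith))
    rw [norm_exp_neg_add_mul_I] at hl
    rw [norm_mul, norm_pow, Complex.norm_I, one_mul, one_mul]
    have h4 : exp (-s / 2) ≤ 1 / 2 := by
      rw [neg_div]; exact exp_neg_le_half (by linarith)
    have e : exp (-s) = exp (-s / 2) ^ 2 := by rw [← exp_nat_mul]; congr 1; push_cast; ring
    rw [e] at hl
    have h5 := exp_pos (-s / 2)
    have h6 : 3 / 2 * exp (-s / 2) ^ 2 ≤ 3 / 4 * exp (-s / 2) := by nlinarith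
    calc _ ≤ (3 / 4 * exp (-s / 2)) ^ 2 := by gcongr; exact hl.trans h6
      _ ≤ _ := by nlinarith
  obtain ⟨-, h1, h2, h3⟩ := integral_boundary_halfStrip_re (C := 1) (R := 2) pi_div_two_pos
    (fun w hw => (hdiff w hw).continuousAt.continuousWithinAt)
    (fun w hw => (hdiff w (mem_strip_of_interior hw)).differentiableWithinAt) hb (f := fun _ => 0)
    (g := fun s => -(log (1 + exp (-s) ^ 2) * arctan (exp (-s))))
    (h := fun t => log (2 * cos (t / 2)) ^ 2 - (t / 2) ^ 2)
    (by
      intro s hs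
      have : Complex.log (1 + Complex.exp (-s)) = (log (1 + exp (-s)) : ℝ) := by
        rw [Complex.ofReal_log (by positivity)]; push_cast; rfl
      rw [this]
      generalize log (1 + exp (-s)) = a
      simp [pow_two])
    (by
      intro s hs
      rw [exp_neg_add_pi_div_two_mul_I, log_one_add_mul_I]
      generalize log (1 + exp (-s) ^ 2) = a
      generalize arctan (exp (-s)) = b
      simp [pow_two]
      ring)
    (by
      intro t ht
      rw [log_one_add_exp_mul_I (by linarith [ht.1, pi_pos]) (by linarith [ht.2, pi_pos])]
      simp [pow_two])
  rw [integrableOn_comp_exp_neg_iff (fun y => -(log (1 + y ^ 2) * arctan y))] at h1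
  rw [integral_comp_exp_neg (fun y => -(log (1 + y ^ 2) * arctan y))] at h3
  simp only [neg_div] at h1 h3
  rw [integral_neg, integral_zero] at h3
  refine ⟨by simpa using h1.neg, h2, by linarith⟩

theorem one_sub_div_one_add_mem_slitPlane {e : ℂ} (h0 : 0 ≤ e.re)
    (h : ‖e‖ < 1 ∨ ‖e‖ = 1 ∧ e.im ≠ 0) : (1 - e) / (1 + e) ∈ Complex.slitPlane := by
  have hn : 0 < Complex.normSq (1 + e) := by
    rw [Complex.normSq_apply]
    simp
    nlinarith [mul_self_nonneg e.im]
  rw [Complex.mem_slitPlane_iff]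
  rcases h with h | ⟨-, h⟩
  · left
    have h2 : e.re * e.re + e.im * e.im < 1 := by
      rw [← Complex.normSq_apply, Complex.normSq_eq_norm_sq]
      nlinarith [norm_nonneg e]
    rw [Complex.div_re, ← add_div]
    apply div_pos _ hn
    simp
    nlinarith
  · right
    rw [Complex.div_im, ← sub_div]
    apply div_ne_zero _ hn.ne'
    simp
    intro h3
    apply h
    linarith

theorem tendsto_self_div_exp_sub_one :
    Tendsto (fun w : ℂ => w / (Complex.exp w - 1)) (𝓝[≠] 0) (𝓝 1) := by
  have h := (hasDerivAt_iff_tendsto_slope.1 (Complex.hasDerivAt_exp 0)).inv₀ (by simp)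
  rw [Complex.exp_zero, inv_one] at h
  refine h.congr fun w => ?_
  rw [slope_def_field]
  simp

theorem tendsto_mul_clog_zero : Tendsto (fun q : ℂ => q * Complex.log q) (𝓝 0) (𝓝 0) := by
  have h1 : Tendsto (fun q : ℂ => |‖q‖ * log ‖q‖| + ‖q‖ * π) (𝓝 0) (𝓝 0) := by
    have : Continuous fun q : ℂ => |‖q‖ * log ‖q‖| + ‖q‖ * π :=
      (Real.continuous_mul_log.comp continuous_norm).abs.add (continuous_norm.mul_const π)
    simpa using this.tendsto 0
  refine squeeze_zero_norm (fun q => ?_) h1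
  rw [norm_mul, abs_mul, abs_norm, ← mul_add]
  gcongr
  calc ‖Complex.log q‖ ≤ |(Complex.log q).re| + |(Complex.log q).im| :=
        Complex.norm_le_abs_re_add_abs_im _
    _ ≤ _ := by
      rw [Complex.log_re, Complex.log_im]
      gcongr
      exact Complex.abs_arg_le_pi q

/-- The integrand `w² log (-tanh (w / 2)) coth w`. -/
noncomputable def tanhCothKernel (w : ℂ) : ℂ :=
  w ^ 2 * Complex.log ((1 - Complex.exp w) / (1 + Complex.exp w)) *
    ((Complex.exp w ^ 2 + 1) / (Complex.exp w ^ 2 - 1))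

theorem one_sub_exp_div_mem_slitPlane {w : ℂ} (hw : w ∈ Iic 0 ×ℂ Icc 0 (π / 2)) (h0 : w ≠ 0) :
    (1 - Complex.exp w) / (1 + Complex.exp w) ∈ Complex.slitPlane := by
  refine one_sub_div_one_add_mem_slitPlane (re_exp_nonneg_of_mem_strip hw) ?_
  rw [Complex.mem_reProdIm] at hw
  rw [Complex.norm_exp, Complex.exp_im]
  rcases (mem_Iic.1 hw.1).lt_or_eq with h | h
  · left; simpa using h
  · right
    rw [h]
    refine ⟨by simp, ?_⟩
    have h1 : 0 < w.im := hw.2.1.lt_of_ne' fun h' => h0 (Complex.ext h h')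
    simpa using (sin_pos_of_pos_of_lt_pi h1 (by linarith [hw.2.2, pi_pos])).ne'

theorem one_add_exp_ne_zero_of_mem_strip {w : ℂ} (hw : w ∈ Iic 0 ×ℂ Icc 0 (π / 2)) :
    1 + Complex.exp w ≠ 0 := by
  intro h
  have h1 := re_exp_nonneg_of_mem_strip hw
  have := congrArg Complex.re h
  simp at this
  linarith

theorem one_sub_exp_ne_zero_of_mem_strip {w : ℂ} (hw : w ∈ Iic 0 ×ℂ Icc 0 (π / 2)) (h0 : w ≠ 0) :
    1 - Complex.exp w ≠ 0 := by
  intro h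
  have := one_sub_exp_div_mem_slitPlane hw h0
  rw [h, zero_div] at this
  simp at this

theorem exp_sq_sub_one_ne_zero_of_mem_strip {w : ℂ} (hw : w ∈ Iic 0 ×ℂ Icc 0 (π / 2))
    (h0 : w ≠ 0) : Complex.exp w ^ 2 - 1 ≠ 0 := by
  have : Complex.exp w ^ 2 - 1 = -((1 - Complex.exp w) * (1 + Complex.exp w)) := by ring
  rw [this, neg_ne_zero]
  exact mul_ne_zero (one_sub_exp_ne_zero_of_mem_strip hw h0) (one_add_exp_ne_zero_of_mem_strip hw)

theorem differentiableAt_tanhCothKernel {w : ℂ} (hw : w ∈ Iic 0 ×ℂ Icc 0 (π / 2)) (h0 : w ≠ 0) :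
    DifferentiableAt ℂ tanhCothKernel w := by
  have he : DifferentiableAt ℂ Complex.exp w := Complex.differentiableAt_exp
  have hq : DifferentiableAt ℂ (fun w => (1 - Complex.exp w) / (1 + Complex.exp w)) w :=
    (he.const_sub 1).fun_div (he.const_add 1) (one_add_exp_ne_zero_of_mem_strip hw)
  have hr : DifferentiableAt ℂ (fun w => (Complex.exp w ^ 2 + 1) / (Complex.exp w ^ 2 - 1)) w :=
    ((he.fun_pow 2).add_const 1).fun_div ((he.fun_pow 2).sub_const 1)
      (exp_sq_sub_one_ne_zero_of_mem_strip hw h0)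
  exact ((differentiableAt_fun_id.fun_pow 2).fun_mul
    (hq.clog (one_sub_exp_div_mem_slitPlane hw h0))).fun_mul hr

theorem continuousOn_tanhCothKernel :
    ContinuousOn tanhCothKernel (Iic 0 ×ℂ Icc 0 (π / 2)) := by
  intro w hw
  by_cases h0 : w ≠ 0
  · exact (differentiableAt_tanhCothKernel hw h0).continuousAt.continuousWithinAt
  push Not at h0
  subst h0
  rw [← continuousWithinAt_sdiff_self, ContinuousWithinAt]
  have hz : tanhCothKernel 0 = 0 := by simp [tanhCothKernel]
  rw [hz]
  have hle : 𝓝[(Iic 0 ×ℂ Icc 0 (π / 2)) \ {0}] (0 : ℂ) ≤ 𝓝[≠] 0 :=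
    nhdsWithin_mono _ fun x hx => hx.2
  have h1 := tendsto_self_div_exp_sub_one.mono_left hle
  have hce : Tendsto Complex.exp (𝓝[(Iic 0 ×ℂ Icc 0 (π / 2)) \ {0}] (0 : ℂ)) (𝓝 1) := by
    have := (Complex.continuous_exp.tendsto 0).mono_left
      (nhdsWithin_le_nhds (s := (Iic 0 ×ℂ Icc 0 (π / 2)) \ {0}))
    simpa using this
  have hq : Tendsto (fun w => (1 - Complex.exp w) / (1 + Complex.exp w))
      (𝓝[(Iic 0 ×ℂ Icc 0 (π / 2)) \ {0}] (0 : ℂ)) (𝓝 0) := by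
    have := (hce.const_sub 1).div (hce.const_add 1) (by norm_num)
    rw [sub_self, zero_div] at this
    exact this
  have h2 := tendsto_mul_clog_zero.comp hq
  have h3 := ((h2.mul (h1.pow 2)).mul ((hce.pow 2).add_const 1)).neg
  simp only [zero_mul, neg_zero] at h3
  refine h3.congr' ?_
  filter_upwards [self_mem_nhdsWithin] with w hw
  have e1 := one_add_exp_ne_zero_of_mem_strip hw.1
  have e2 := one_sub_exp_ne_zero_of_mem_strip hw.1 hw.2
  have e3 := exp_sq_sub_one_ne_zero_of_mem_strip hw.1 hw.2
  have e4 : Complex.exp w - 1 ≠ 0 := by rw [← neg_sub]; exact neg_ne_zero.2 e2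
  simp only [tanhCothKernel, Function.comp]
  generalize Complex.log _ = l
  field_simp
  ring

theorem norm_tanhCothKernel_le {s : ℝ} (hs : 3 ≤ s) {y : ℝ} (hy : y ∈ Icc 0 (π / 2)) :
    ‖tanhCothKernel (-s + y * Complex.I)‖ ≤ 800 * exp (-s / 2) := by
  have hn := norm_exp_neg_add_mul_I s y
  have hx : exp (-s) ≤ 1 / 8 := by
    have h1 : exp (-s) = exp (-s / 3) ^ 3 := by rw [← exp_nat_mul]; congr 1; push_cast; ring
    have h2 : exp (-s / 3) ≤ 1 / 2 := by rw [neg_div]; exact exp_neg_le_half (by linarith)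
    rw [h1]
    calc exp (-s / 3) ^ 3 ≤ (1 / 2) ^ 3 := by gcongr
      _ = 1 / 8 := by norm_num
  have hw2 : ‖(-s + y * Complex.I : ℂ)‖ ^ 2 ≤ s ^ 2 + 4 := by
    rw [← Complex.normSq_eq_norm_sq, Complex.normSq_apply]
    simp
    nlinarith [hy.1, hy.2, pi_lt_d2, pi_pos]
  set e := Complex.exp (-s + y * Complex.I)
  have h1e : 7 / 8 ≤ ‖1 + e‖ := by
    have := norm_sub_norm_le (1 : ℂ) (-e)
    rw [norm_one, norm_neg, sub_neg_eq_add, hn] at this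
    linarith
  have hne : 1 + e ≠ 0 := by
    intro h; rw [h, norm_zero] at h1e; norm_num at h1e
  have hlog : ‖Complex.log ((1 - e) / (1 + e))‖ ≤ 4 * exp (-s) := by
    have eq : (1 - e) / (1 + e) = 1 + -2 * e / (1 + e) := by field_simp; ring
    have hz : ‖-2 * e / (1 + e)‖ ≤ 16 / 7 * exp (-s) := by
      rw [norm_div, norm_mul, hn, div_le_iff₀ (by linarith)]
      simp
      nlinarith [exp_pos (-s)]
    rw [eq]
    have := Complex.norm_log_one_add_half_le_self (hz.trans (by linarith))
    linarith [exp_pos (-s)]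
  have hcoth : ‖(e ^ 2 + 1) / (e ^ 2 - 1)‖ ≤ 2 := by
    have h2 : ‖e ^ 2‖ ≤ 1 / 64 := by
      rw [norm_pow, hn]
      calc exp (-s) ^ 2 ≤ (1 / 8) ^ 2 := by gcongr
        _ = _ := by norm_num
    have h3 := norm_add_le (e ^ 2) 1
    have h4 := norm_sub_norm_le 1 (e ^ 2)
    rw [norm_one] at h3 h4
    rw [norm_sub_rev] at h4
    rw [norm_div, div_le_iff₀ (by linarith)]
    linarith
  have hq : s ^ 2 + 4 ≤ 100 * exp (s / 2) := by
    have := Real.quadratic_le_exp_of_nonneg (x := s / 2) (by linarith)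
    nlinarith
  have hexp : exp (s / 2) * exp (-s) = exp (-s / 2) := by rw [← exp_add]; congr 1; ring
  calc ‖tanhCothKernel (-s + y * Complex.I)‖
      = ‖(-s + y * Complex.I : ℂ)‖ ^ 2 * ‖Complex.log ((1 - e) / (1 + e))‖ *
        ‖(e ^ 2 + 1) / (e ^ 2 - 1)‖ := by
        rw [tanhCothKernel, norm_mul, norm_mul, norm_pow]
    _ ≤ (100 * exp (s / 2)) * (4 * exp (-s)) * 2 := by
        gcongr
        exact hw2.trans hq
    _ = _ := by rw [← hexp]; ring

theorem log_one_sub_mul_I_div (y : ℝ) :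
    Complex.log ((1 - y * Complex.I) / (1 + y * Complex.I)) = -(2 * arctan y : ℝ) * Complex.I := by
  have h : Complex.arctan ((-y : ℝ) : ℂ) = (arctan (-y) : ℝ) := (Complex.ofReal_arctan _).symm
  rw [Complex.arctan, arctan_neg] at h
  have e : (1 - y * Complex.I) / (1 + y * Complex.I) =
      (1 + ((-y : ℝ) : ℂ) * Complex.I) / (1 - ((-y : ℝ) : ℂ) * Complex.I) := by
    push_cast; ring
  rw [e]
  generalize Complex.log _ = l at h ⊢
  generalize arctan y = a at h ⊢
  push_cast at h ⊢
  linear_combination (2 * Complex.I) * h + l * Complex.I_sq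

theorem log_neg_I_mul {x : ℝ} (hx : 0 < x) :
    Complex.log (x * -Complex.I) = log x - (π / 2 : ℝ) * Complex.I := by
  rw [Complex.log_ofReal_mul hx (by simp), Complex.log_neg_I]
  push_cast
  ring

theorem one_sub_exp_mul_I_div {t : ℝ} (h : cos (t / 2) ≠ 0) :
    (1 - Complex.exp (t * Complex.I)) / (1 + Complex.exp (t * Complex.I)) =
      (tan (t / 2) : ℝ) * -Complex.I := by
  have h' : Complex.cos (t / 2) ≠ 0 := by exact_mod_cast h
  have e : Complex.exp (t * Complex.I) = (Complex.cos (t / 2) + Complex.sin (t / 2) *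
    Complex.I) ^ 2 := by
    rw [← Complex.exp_mul_I, ← Complex.exp_nat_mul]; congr 1; push_cast; ring
  have h2 := Complex.sin_sq_add_cos_sq (t / 2)
  rw [e]
  push_cast
  rw [Complex.tan_eq_sin_div_cos]
  generalize Complex.sin (t / 2) = d at h2 ⊢
  generalize Complex.cos (t / 2) = c at h2 h' ⊢
  have hden : 1 + (c + d * Complex.I) ^ 2 = 2 * c * (c + d * Complex.I) := by
    linear_combination (-1 : ℂ) * h2 + d ^ 2 * Complex.I_sq
  have hnum : 1 - (c + d * Complex.I) ^ 2 = -(2 * d * Complex.I * (c + d * Complex.I)) := by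
    linear_combination (-1 : ℂ) * h2 + d ^ 2 * Complex.I_sq
  have hne : c + d * Complex.I ≠ 0 := by
    intro h0
    have : (c - d * Complex.I) * (c + d * Complex.I) = 1 := by
      linear_combination h2 - d ^ 2 * Complex.I_sq
    rw [h0, mul_zero] at this
    exact zero_ne_one this
  rw [hden, hnum]
  field_simp

theorem exp_mul_I_sq_add_one_div {t : ℝ} (h : sin t ≠ 0) :
    (Complex.exp (t * Complex.I) ^ 2 + 1) / (Complex.exp (t * Complex.I) ^ 2 - 1) =
      (cos t / sin t : ℝ) * -Complex.I := by
  have h' : Complex.sin t ≠ 0 := by exact_mod_cast h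
  have h2 := Complex.sin_sq_add_cos_sq t
  rw [Complex.exp_mul_I]
  push_cast
  generalize Complex.sin t = d at h2 h' ⊢
  generalize Complex.cos t = c at h2 ⊢
  have hnum : (c + d * Complex.I) ^ 2 + 1 = 2 * c * (c + d * Complex.I) := by
    linear_combination (-1 : ℂ) * h2 + d ^ 2 * Complex.I_sq
  have hden : (c + d * Complex.I) ^ 2 - 1 = 2 * d * Complex.I * (c + d * Complex.I) := by
    linear_combination h2 - d ^ 2 * Complex.I_sq
  have hne : c + d * Complex.I ≠ 0 := by
    intro h0
    have : (c - d * Complex.I) * (c + d * Complex.I) = 1 := by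
      linear_combination h2 - d ^ 2 * Complex.I_sq
    rw [h0, mul_zero] at this
    exact zero_ne_one this
  have hI := Complex.I_ne_zero
  rw [hden, hnum]
  field_simp
  simp

/-- Part of the contour integral of `tanhCothKernel`. -/
theorem integral_sq_mul_cot_mul_log_tan :
    IntegrableOn (fun y => log y * arctan y * (1 - y ^ 2) / (y * (1 + y ^ 2))) (Ioo 0 1) ∧
    IntegrableOn (fun t => t ^ 2 * (cos t / sin t) * log (tan (t / 2))) (Ioo 0 (π / 2)) ∧
    ∫ t in Ioo 0 (π / 2), t ^ 2 * (cos t / sin t) * log (tan (t / 2)) =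
      2 * π * (∫ y in Ioo (0 : ℝ) 1, log y * arctan y * (1 - y ^ 2) / (y * (1 + y ^ 2))) +
      (-8 * rpolylog 4 (1 / 2) - log 2 ^ 4 / 3 + π ^ 2 * log 2 ^ 2 / 3 + 53 * π ^ 4 / 720) := by
  have hQ := integral_log_sq_mul_log_div
  obtain ⟨h0, h1, h2, h3⟩ := integral_boundary_halfStrip_re (C := 800) (R := 3) pi_div_two_pos
    continuousOn_tanhCothKernel
    (fun w hw => (differentiableAt_tanhCothKernel (mem_strip_of_interior hw)
      (by rintro rfl; rw [Complex.mem_reProdIm] at hw; simp at hw)).differentiableWithinAt)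
    (fun s hs y hy => norm_tanhCothKernel_le hs hy)
    (f := fun s => (fun z => log z ^ 2 * (log (1 - z) - log (1 + z)) *
      ((z ^ 2 + 1) / (z ^ 2 - 1))) (exp (-s)))
    (g := fun s => (fun y => -2 * π * (log y * arctan y * (1 - y ^ 2) / (1 + y ^ 2))) (exp (-s)))
    (h := fun t => t ^ 2 * (cos t / sin t) * log (tan (t / 2)))
    (by
      intro s hs
      have hx : exp (-s) < 1 := by simpa using hs
      have hx0 := exp_pos (-s)
      rw [tanhCothKernel]
      have e1 : Complex.exp (-s) = (exp (-s) : ℝ) := by push_cast; rfl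
      have e2 : Complex.log ((1 - Complex.exp (-s)) / (1 + Complex.exp (-s))) =
          (log (1 - exp (-s)) - log (1 + exp (-s)) : ℝ) := by
        rw [← log_div (by linarith) (by linarith),
          Complex.ofReal_log (div_pos (by linarith) (by linarith)).le, e1]
        push_cast; rfl
      rw [e2, e1]
      simp only [log_exp]
      generalize exp (-s) = x
      norm_cast)
    (by
      intro s hs
      rw [tanhCothKernel, exp_neg_add_pi_div_two_mul_I, log_one_sub_mul_I_div, mul_pow,
        Complex.I_sq]
      simp only [log_exp]
      generalize exp (-s) = x
      generalize arctan x = a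
      have e3 : ((x : ℂ) ^ 2 * -1 + 1) / ((x : ℂ) ^ 2 * -1 - 1) =
        (-((1 - x ^ 2) / (1 + x ^ 2)) : ℝ) := by
        rw [← neg_div_neg_eq, neg_div]
        push_cast
        ring
      have e4 : -s * a * (1 - x ^ 2) / (1 + x ^ 2) = -s * a * ((1 - x ^ 2) / (1 + x ^ 2)) := by ring
      rw [e3, e4]
      generalize (1 - x ^ 2) / (1 + x ^ 2) = b
      simp [pow_two]
      ring)
    (by
      intro t ht
      have hc : 0 < cos (t / 2) := cos_pos_of_mem_Ioo ⟨by linarith [ht.1, pi_pos],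
        by linarith [ht.2, pi_pos]⟩
      have htan : 0 < tan (t / 2) := tan_pos_of_pos_of_lt_pi_div_two (by linarith [ht.1])
        (by linarith [ht.2, pi_pos])
      have hs : sin t ≠ 0 := (sin_pos_of_pos_of_lt_pi ht.1 (by linarith [ht.2, pi_pos])).ne'
      have e5 := exp_mul_I_sq_add_one_div hs
      rw [tanhCothKernel, one_sub_exp_mul_I_div hc.ne', log_neg_I_mul htan, e5]
      generalize log (tan (t / 2)) = l
      generalize cos t / sin t = c
      simp [pow_two]
      ring)
  rw [integrableOn_comp_exp_neg_iff (fun y => -2 * π *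
    (log y * arctan y * (1 - y ^ 2) / (1 + y ^ 2)))] at h1
  rw [integral_comp_exp_neg (fun y => -2 * π * (log y * arctan y * (1 - y ^ 2) / (1 + y ^ 2))),
    integral_comp_exp_neg (fun z => log z ^ 2 * (log (1 - z) - log (1 + z)) *
      ((z ^ 2 + 1) / (z ^ 2 - 1)))] at h3
  have e6 : ∀ y : ℝ, log y * arctan y * (1 - y ^ 2) / (y * (1 + y ^ 2)) =
      (-1 / (2 * π)) * (-2 * π * (log y * arctan y * (1 - y ^ 2) / (1 + y ^ 2)) / y) := by
    intro y
    have := pi_ne_zero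
    have : 1 + y ^ 2 ≠ 0 := by positivity
    by_cases hy : y = 0
    · simp [hy]
    field_simp
  have e7 : ∀ z : ℝ, log z ^ 2 * (log (1 - z) - log (1 + z)) * ((z ^ 2 + 1) / (z ^ 2 - 1)) / z =
      log z ^ 2 * (log (1 - z) - log (1 + z)) * ((z ^ 2 + 1) / (z * (z ^ 2 - 1))) := by
    intro z
    rw [mul_div_assoc, div_div, mul_comm z]
  simp only [e7, hQ.2] at h3
  simp only [e6]
  refine ⟨h1.const_mul _, h2, ?_⟩
  rw [integral_const_mul]
  have e8 (A : ℝ) : 2 * π * (-1 / (2 * π) * A) = -A := by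
    have := pi_ne_zero
    field_simp
  rw [e8]
  linarith

theorem HasSum.congr_sum {f : ℕ → ℝ} {a b : ℝ} (h : HasSum f a) (hab : a = b) : HasSum f b :=
  hab ▸ h

theorem integral_log_sq_div_one_add_sq :
    HasIntegralOn (fun y => 1 / (1 + y ^ 2) * log y ^ 2) (Ioo 0 1) (π ^ 3 / 16) := by
  have hs : Summable fun n : ℕ => |(-1 : ℝ) ^ n| *
    ((2 : ℕ).factorial / (((2 * n : ℕ) : ℝ) + 1) ^ (2 + 1)) := by
    refine ((summable_one_div_succ_pow (k := 3) (by norm_num)).mul_left 2).of_nonneg_of_le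
      (fun n => by positivity) (fun n => ?_)
    rw [abs_pow, abs_neg, abs_one, one_pow, one_mul, mul_one_div]
    norm_num [Nat.factorial]
    gcongr
    linarith [n.cast_nonneg (α := ℝ)]
  obtain ⟨h1, h2⟩ := integrable_and_hasSum_mul_log_pow 2 (a := fun n => (-1) ^ n) (e := fun n => 2 *
    n)
    (g := fun y => 1 / (1 + y ^ 2)) (fun y hy => by
      have := hasSum_geometric_of_abs_lt_one (r := -y ^ 2)
        (by rw [abs_neg, abs_of_nonneg (by positivity)]; nlinarith [hy.1, hy.2])
      rw [sub_neg_eq_add, ← one_div] at this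
      exact this.congr_fun fun n => (by rw [pow_mul, ← mul_pow, neg_one_mul])) hs
  refine ⟨h1, ?_⟩
  have h3 := hasSum_L_function_mod_four_eval_three
  have hinj : Function.Injective fun n : ℕ => 2 * n + 1 := fun a b h => by simpa using h
  rw [← hinj.hasSum_iff] at h3
  · have h4 := h3.mul_left 2
    refine (h2.congr_fun fun n => ?_).unique (h4.congr_sum ?_)
    · simp only [Function.comp]
      have : sin (π * ((2 * n + 1 : ℕ) : ℝ) / 2) = (-1) ^ n := by
        have e : π * ((2 * n + 1 : ℕ) : ℝ) / 2 = n * π + π / 2 := by push_cast; ring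
        rw [e, sin_add_pi_div_two, cos_nat_mul_pi]
      rw [this]
      push_cast
      norm_num [Nat.factorial]
      ring
    · ring
  · intro n hn
    have : sin (π * n / 2) = 0 := by
      rw [sin_eq_zero_iff]
      have he : Even n := by
        by_contra h
        obtain ⟨k, hk⟩ := Nat.not_even_iff_odd.1 h
        exact hn ⟨k, hk.symm⟩
      obtain ⟨k, rfl⟩ := he
      exact ⟨k, by push_cast; ring⟩
    rw [this, mul_zero]

theorem integral_mul_log_div_one_add_sq :
    HasIntegralOn (fun y => y / (1 + y ^ 2) * log y) (Ioo 0 1) (-π ^ 2 / 48) := by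
  have hs : Summable fun n : ℕ =>
      |(-1 : ℝ) ^ n| * ((1 : ℕ).factorial / (((2 * n + 1 : ℕ) : ℝ) + 1) ^ (1 + 1)) := by
    refine ((summable_one_div_succ_pow (k := 2) (by norm_num))).of_nonneg_of_le
      (fun n => by positivity) (fun n => ?_)
    rw [abs_pow, abs_neg, abs_one, one_pow, one_mul, Nat.factorial_one, Nat.cast_one]
    have h : (n : ℝ) + 1 ≤ ((2 * n + 1 : ℕ) : ℝ) + 1 := by
      have : n ≤ 2 * n + 1 := by lia
      have : (n : ℝ) ≤ ((2 * n + 1 : ℕ) : ℝ) := by exact_mod_cast this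
      linarith
    gcongr
  obtain ⟨h1, h2⟩ := integrable_and_hasSum_mul_log_pow 1 (a := fun n => (-1) ^ n)
    (e := fun n => 2 * n + 1)
    (g := fun y => y / (1 + y ^ 2)) (fun y hy => by
      have := (hasSum_geometric_of_abs_lt_one (r := -y ^ 2)
        (by rw [abs_neg, abs_of_nonneg (by positivity)]; nlinarith [hy.1, hy.2])).mul_left y
      rw [sub_neg_eq_add, ← div_eq_mul_inv] at this
      exact this.congr_fun fun n => (by rw [pow_succ, pow_mul, ← mul_assoc, ← mul_pow, neg_one_mul,
        mul_comm])) hs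
  have h3 := ((hasSum_one_div_odd_pow (k := 2) hasSum_one_div_succ_sq).2).mul_left (-1 / 4)
  refine ⟨by simpa using h1, ?_⟩
  simp only [pow_one] at h2
  refine (h2.congr_fun fun n => ?_).unique (h3.congr_sum ?_)
  · push_cast
    have : (2 * (n : ℝ) + 1 + 1) = 2 * (n + 1) := by ring
    rw [this]
    field_simp
    norm_num
  · ring

theorem HasIntegralOn.comp_image {E : Type*} [NormedAddCommGroup E] [NormedSpace ℝ E] {g : ℝ → E}
    {f f' : ℝ → ℝ} {s : Set ℝ} {v : E}
    (h : HasIntegralOn g (f '' s) v) (hs : MeasurableSet s) (hf : ∀ x ∈ s, HasDerivAt f (f' x) x)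
    (hinj : InjOn f s) : HasIntegralOn (fun x => |f' x| • g (f x)) s v := by
  have hf' : ∀ x ∈ s, HasDerivWithinAt f (f' x) s x := fun x hx => (hf x hx).hasDerivWithinAt
  exact ⟨(integrableOn_image_iff_integrableOn_abs_deriv_smul hs hf' hinj g).1 h.1,
    (integral_image_eq_integral_abs_deriv_smul hs hf' hinj g).symm.trans h.2⟩

theorem image_tan_Ioo_zero_pi_div_four : tan '' Ioo 0 (π / 4) = Ioo 0 1 := by
  ext y
  constructor
  · rintro ⟨t, ht, rfl⟩
    refine ⟨tan_pos_of_pos_of_lt_pi_div_two ht.1 (by linarith [ht.2, pi_pos]), ?_⟩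
    rw [← tan_pi_div_four]
    exact tan_lt_tan_of_nonneg_of_lt_pi_div_two ht.1.le (by linarith [pi_pos]) ht.2
  · rintro ⟨h0, h1⟩
    refine ⟨arctan y, ⟨arctan_pos.2 h0, ?_⟩, tan_arctan y⟩
    rw [← arctan_one]
    exact arctan_strictMono h1

theorem cos_pos_of_mem_Ioo_pi_div_four {t : ℝ} (ht : t ∈ Ioo 0 (π / 4)) : 0 < cos t :=
  cos_pos_of_mem_Ioo ⟨by linarith [ht.1, pi_pos], by linarith [ht.2, pi_pos]⟩

theorem sin_pos_of_mem_Ioo_pi_div_four {t : ℝ} (ht : t ∈ Ioo 0 (π / 4)) : 0 < sin t :=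
  sin_pos_of_pos_of_lt_pi ht.1 (by linarith [ht.2, pi_pos])

theorem HasIntegralOn.comp_tan {g : ℝ → ℝ} {v : ℝ} (h : HasIntegralOn g (Ioo 0 1) v) :
    HasIntegralOn (fun t => g (tan t) / cos t ^ 2) (Ioo 0 (π / 4)) v := by
  rw [← image_tan_Ioo_zero_pi_div_four] at h
  refine (h.comp_image measurableSet_Ioo
    (fun t ht => hasDerivAt_tan (cos_pos_of_mem_Ioo_pi_div_four ht).ne') ?_).congr measurableSet_Ioo
    (fun t ht => ?_) rfl
  · intro a ha b hb hab
    exact tan_inj_of_lt_of_lt_pi_div_two (by linarith [ha.1, pi_pos]) (by linarith [ha.2, pi_pos])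
      (by linarith [hb.1, pi_pos]) (by linarith [hb.2, pi_pos]) hab
  · rw [abs_of_nonneg (by positivity), smul_eq_mul]
    ring

theorem HasIntegralOn.comp_two_mul {g : ℝ → ℝ} {a v : ℝ} (h : HasIntegralOn g (Ioo 0 (2 * a)) v) :
    HasIntegralOn (fun t => g (2 * t)) (Ioo 0 a) (v / 2) := by
  have e : (fun x : ℝ => 2 * x) '' Ioo 0 a = Ioo 0 (2 * a) := by
    rw [image_mul_left_Ioo two_pos, mul_zero]
  rw [← e] at h
  refine ((h.comp_image (f' := fun _ => 2) measurableSet_Ioo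
    (fun t ht => by simpa using (hasDerivAt_id t).const_mul (2 : ℝ))
    (fun a _ b _ hab => by simpa using hab)).const_mul (1 / 2)).congr measurableSet_Ioo
    (fun t ht => ?_) (by ring)
  simp

theorem HasIntegralOn.comp_sub_left {g : ℝ → ℝ} {a b c v : ℝ}
    (h : HasIntegralOn g (Ioo (c - b) (c - a)) v) :
    HasIntegralOn (fun t => g (c - t)) (Ioo a b) v := by
  rw [← image_const_sub_Ioo] at h
  refine (h.comp_image (f' := fun _ => -1) measurableSet_Ioo
    (fun t ht => by simpa using (hasDerivAt_id t).const_sub c)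
    (fun a _ b _ hab => by simpa using hab)).congr measurableSet_Ioo
    (fun t ht => ?_) rfl
  simp

theorem HasIntegralOn.union_Ioo {g : ℝ → ℝ} {a b c v w : ℝ} (hab : a < b) (hbc : b < c)
    (h1 : HasIntegralOn g (Ioo a b) v) (h2 : HasIntegralOn g (Ioo b c) w) :
    HasIntegralOn g (Ioo a c) (v + w) := by
  have i1 := (intervalIntegrable_iff_integrableOn_Ioo_of_le hab.le).2 h1.1
  have i2 := (intervalIntegrable_iff_integrableOn_Ioo_of_le hbc.le).2 h2.1
  refine ⟨(intervalIntegrable_iff_integrableOn_Ioo_of_le (hab.trans hbc).le).1 (i1.trans i2), ?_⟩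
  rw [← h1.2, ← h2.2, ← integral_Ioc_eq_integral_Ioo, ← integral_Ioc_eq_integral_Ioo,
    ← integral_Ioc_eq_integral_Ioo, ← intervalIntegral.integral_of_le hab.le,
    ← intervalIntegral.integral_of_le hbc.le, ← intervalIntegral.integral_of_le (hab.trans hbc).le,
    intervalIntegral.integral_add_adjacent_intervals i1 i2]

theorem integral_log_tan_sq : HasIntegralOn (fun t =>
  log (tan t) ^ 2) (Ioo 0 (π / 4)) (π ^ 3 / 16) := by
  refine integral_log_sq_div_one_add_sq.comp_tan.congr measurableSet_Ioo (fun t ht => ?_) rfl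
  have hc := (cos_pos_of_mem_Ioo_pi_div_four ht).ne'
  rw [one_div, inv_one_add_tan_sq hc]
  field_simp

theorem integral_tan_mul_log_tan :
    HasIntegralOn (fun t => tan t * log (tan t)) (Ioo 0 (π / 4)) (-π ^ 2 / 48) := by
  refine integral_mul_log_div_one_add_sq.comp_tan.congr measurableSet_Ioo (fun t ht => ?_) rfl
  have hc := (cos_pos_of_mem_Ioo_pi_div_four ht).ne'
  rw [div_eq_mul_inv _ (1 + _), inv_one_add_tan_sq hc]
  field_simp

theorem log_tan {t : ℝ} (ht : t ∈ Ioo 0 (π / 4)) :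
    log (tan t) = log (2 * sin t) - log (2 * cos t) := by
  have hc := (cos_pos_of_mem_Ioo_pi_div_four ht)
  have hs := (sin_pos_of_mem_Ioo_pi_div_four ht)
  rw [← log_div (by positivity) (by positivity), tan_eq_sin_div_cos]
  congr 1
  field_simp

theorem abs_log_two_mul_sin_le {t : ℝ} (ht : t ∈ Ioo 0 (π / 4)) :
    |log (2 * sin t)| ≤ |log t| + 1 := by
  have hs := sin_pos_of_mem_Ioo_pi_div_four ht
  have h1 : t ≤ 2 * sin t := by
    have := mul_le_sin ht.1.le (by linarith [ht.2, pi_pos])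
    have h2 : 1 / 2 ≤ 2 / π := by
      rw [div_le_div_iff₀ two_pos pi_pos]; linarith [pi_lt_four]
    nlinarith [ht.1]
  have h2 := log_le_log ht.1 h1
  have h3 : log (2 * sin t) ≤ 1 := by
    have : log (2 * sin t) ≤ log 2 := log_le_log (by positivity) (by linarith [sin_le_one t])
    linarith [log_two_lt_d9]
  have := neg_abs_le (log t)
  rw [abs_le]
  constructor <;> linarith [abs_nonneg (log t)]

theorem integrableOn_abs_log_add_one_sq :
    IntegrableOn (fun t => (|log t| + 1) ^ 2) (Ioo 0 (π / 4)) := by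
  have h0 : IntegrableOn (fun t : ℝ => 2 * (t ^ 0 * log t ^ 2) + 2) (Ioo 0 1) :=
    ((integrableOn_pow_mul_log_pow 0 2).const_mul 2).add (integrableOn_const (by simp))
  refine (h0.mono_set (Ioo_subset_Ioo_right (by linarith [pi_lt_four]))).mono' ?_ ?_
  · exact ((measurable_log.abs.add_const 1).pow_const 2).aestronglyMeasurable
  · refine Eventually.of_forall fun t => ?_
    rw [norm_of_nonneg (by positivity), ← sq_abs (log t)]
    nlinarith [sq_nonneg (|log t| - 1)]

theorem integrableOn_of_abs_le_log_sq {f : ℝ → ℝ} (hf : Measurable f) (C : ℝ)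
    (h : ∀ t ∈ Ioo 0 (π / 4), |f t| ≤ C * (|log t| + 1) ^ 2) : IntegrableOn f (Ioo 0 (π / 4)) := by
  refine (integrableOn_abs_log_add_one_sq.const_mul C).mono' hf.aestronglyMeasurable ?_
  exact (ae_restrict_iff' measurableSet_Ioo).2 (Eventually.of_forall h)

theorem integrableOn_log_sin_sq : IntegrableOn (fun t => log (2 * sin t) ^ 2) (Ioo 0 (π / 4)) := by
  refine integrableOn_of_abs_le_log_sq (by fun_prop) 1 fun t ht => ?_
  rw [abs_pow, one_mul]
  gcongr
  exact abs_log_two_mul_sin_le ht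

theorem integrableOn_log_sin : IntegrableOn (fun t => log (2 * sin t)) (Ioo 0 (π / 4)) := by
  refine integrableOn_of_abs_le_log_sq (by fun_prop) 1 fun t ht => ?_
  nlinarith [abs_log_two_mul_sin_le ht, abs_nonneg (log t)]

theorem continuousOn_log_cos : ContinuousOn (fun t => log (2 * cos t)) (Icc 0 (π / 4)) := by
  refine ContinuousOn.log (by fun_prop) fun t ht => ?_
  have : 0 < cos t := cos_pos_of_mem_Ioo ⟨by linarith [ht.1, pi_pos], by linarith [ht.2, pi_pos]⟩
  positivity

theorem integrableOn_log_cos_sq : IntegrableOn (fun t => log (2 * cos t) ^ 2) (Ioo 0 (π / 4)) :=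
  integrableOn_Ioo_of_continuousOn_Icc (continuousOn_log_cos.pow 2)

theorem integrableOn_log_cos : IntegrableOn (fun t => log (2 * cos t)) (Ioo 0 (π / 4)) :=
  integrableOn_Ioo_of_continuousOn_Icc continuousOn_log_cos

/-- The doubling formula for `log (2 sin t)`. -/
theorem integral_log_sin_add_log_cos_pow {k : ℕ} {A B : ℝ}
    (hA : HasIntegralOn (fun t => log (2 * sin t) ^ k) (Ioo 0 (π / 4)) A)
    (hB : HasIntegralOn (fun t => log (2 * cos t) ^ k) (Ioo 0 (π / 4)) B) :
    HasIntegralOn (fun t => (log (2 * sin t) + log (2 * cos t)) ^ k) (Ioo 0 (π / 4))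
      ((A + B) / 2) := by
  have hB' : HasIntegralOn (fun t => log (2 * sin t) ^ k) (Ioo (π / 4) (π / 2)) B := by
    have : HasIntegralOn (fun t => log (2 * cos t) ^ k) (Ioo (π / 2 - π / 2) (π / 2 - π / 4)) B
      := by
      convert hB using 2 <;> ring
    simpa only [cos_pi_div_two_sub] using this.comp_sub_left
  have h := hA.union_Ioo (by linarith [pi_pos]) (by linarith [pi_pos]) hB'
  rw [show π / 2 = 2 * (π / 4) by ring] at h
  refine h.comp_two_mul.congr measurableSet_Ioo (fun t ht => ?_) rfl
  have hc := (cos_pos_of_mem_Ioo_pi_div_four ht)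
  have hs := (sin_pos_of_mem_Ioo_pi_div_four ht)
  rw [← log_mul (by positivity) (by positivity), sin_two_mul]
  congr 2
  ring

theorem integral_log_sin_add_integral_log_cos :
    (∫ t in Ioo 0 (π / 4), log (2 * sin t)) + ∫ t in Ioo 0 (π / 4), log (2 * cos t) = 0 := by
  have hA := hasIntegralOn_self integrableOn_log_sin
  have hB := hasIntegralOn_self integrableOn_log_cos
  have h := integral_log_sin_add_log_cos_pow (k := 1) (by simpa using hA) (by simpa using hB)
  simp only [pow_one] at h
  linarith [h.unique (hA.add hB)]

theorem integral_log_sin_sq_add_integral_log_cos_sq :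
    (∫ t in Ioo 0 (π / 4), log (2 * sin t) ^ 2) + ∫ t in Ioo 0 (π / 4), log (2 * cos t) ^ 2 =
      π ^ 3 / 24 := by
  have hA := hasIntegralOn_self integrableOn_log_sin_sq
  have hB := hasIntegralOn_self integrableOn_log_cos_sq
  have h := integral_log_sin_add_log_cos_pow hA hB
  have h2 := (((hA.add hB).const_mul 2).sub integral_log_tan_sq).congr measurableSet_Ioo
    (g := fun t => (log (2 * sin t) + log (2 * cos t)) ^ 2) (fun t ht =>
      by rw [log_tan ht]; ring) rfl
  linarith [h.unique h2]

theorem hasDerivAt_log_two_mul_sin {t : ℝ} (ht : t ∈ Ioo 0 (π / 4)) :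
    HasDerivAt (fun t => log (2 * sin t)) (cos t / sin t) t := by
  have h := sin_pos_of_mem_Ioo_pi_div_four ht
  convert ((hasDerivAt_sin t).const_mul 2).log (by positivity) using 1
  field_simp

theorem hasDerivAt_log_two_mul_cos {t : ℝ} (h : cos t ≠ 0) :
    HasDerivAt (fun t => log (2 * cos t)) (-(sin t / cos t)) t := by
  convert ((hasDerivAt_cos t).const_mul 2).log (by positivity) using 1
  field_simp

theorem tendsto_mul_abs_log_add_one_sq :
    Tendsto (fun t => t * (|log t| + 1) ^ 2) (𝓝[>] 0) (𝓝 0) := by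
  have h1 := tendsto_log_mul_rpow_nhdsGT_zero (r := 1 / 2) (by norm_num)
  have h2 : Tendsto (fun t : ℝ => t ^ (1 / 2 : ℝ)) (𝓝[>] 0) (𝓝 0) := by
    have := (continuous_rpow_const (q := 1 / 2) (by norm_num)).tendsto 0
    rw [zero_rpow (by norm_num)] at this
    exact this.mono_left nhdsWithin_le_nhds
  have h3 := ((h1.abs).add h2).pow 2
  simp only [abs_zero, add_zero, ne_eq, OfNat.ofNat_ne_zero, not_false_eq_true, zero_pow] at h3
  refine h3.congr' ?_
  filter_upwards [self_mem_nhdsWithin] with t ht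
  have h4 : 0 ≤ t ^ (1 / 2 : ℝ) := rpow_nonneg (mem_Ioi.1 ht).le _
  have h5 : (t ^ (1 / 2 : ℝ)) ^ 2 = t := by
    rw [← rpow_natCast, ← rpow_mul (mem_Ioi.1 ht).le]; norm_num
  rw [abs_mul, abs_of_nonneg h4, ← add_one_mul, mul_pow, h5, mul_comm]

theorem tendsto_mul_of_abs_le_log_sq {f : ℝ → ℝ} (C : ℝ)
    (h : ∀ t ∈ Ioo 0 (π / 4), |f t| ≤ C * (|log t| + 1) ^ 2) :
    Tendsto (fun t => t * f t) (𝓝[>] 0) (𝓝 0) := by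
  have h1 := tendsto_mul_abs_log_add_one_sq.const_mul C
  rw [mul_zero] at h1
  refine squeeze_zero_norm' ?_ h1
  filter_upwards [Ioo_mem_nhdsGT (show 0 < π / 4 by positivity)] with t ht
  rw [norm_mul, norm_of_nonneg ht.1.le, norm_eq_abs]
  nlinarith [h t ht, ht.1]

theorem abs_log_two_mul_cos_le {t : ℝ} (ht : t ∈ Icc 0 (π / 4)) : |log (2 * cos t)| ≤ 1 := by
  have h1 : 1 / 2 ≤ cos t := by
    have := one_sub_sq_div_two_le_cos (x := t)
    nlinarith [ht.1, ht.2, pi_lt_four]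
  have h2 : 0 ≤ log (2 * cos t) := log_nonneg (by linarith)
  have h3 : log (2 * cos t) ≤ log 2 := log_le_log (by linarith) (by linarith [cos_le_one t])
  rw [abs_of_nonneg h2]
  linarith [log_two_lt_d9]

theorem half_le_sin {t : ℝ} (ht : t ∈ Ioo 0 (π / 4)) : t / 2 ≤ sin t := by
  have := mul_le_sin ht.1.le (by linarith [ht.2, pi_pos])
  have h2 : 1 / 2 ≤ 2 / π := by
    rw [div_le_div_iff₀ two_pos pi_pos]; linarith [pi_lt_four]
  nlinarith [ht.1]

theorem half_le_cos {t : ℝ} (ht : t ∈ Ioo 0 (π / 4)) : 1 / 2 ≤ cos t := by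
  have := one_sub_sq_div_two_le_cos (x := t)
  nlinarith [ht.1, ht.2, pi_lt_four]

theorem log_two_mul_sin_pi_div_four : log (2 * sin (π / 4)) = log 2 / 2 := by
  rw [sin_pi_div_four, mul_div_cancel₀ _ two_ne_zero, log_sqrt (by norm_num)]

theorem log_two_mul_cos_pi_div_four : log (2 * cos (π / 4)) = log 2 / 2 := by
  rw [cos_pi_div_four, mul_div_cancel₀ _ two_ne_zero, log_sqrt (by norm_num)]

theorem continuousAt_log_two_mul_sin_pi_div_four :
    ContinuousAt (fun t => log (2 * sin t)) (π / 4) :=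
  ContinuousAt.log (by fun_prop) (by rw [sin_pi_div_four]; positivity)

theorem continuousAt_log_two_mul_cos_pi_div_four :
    ContinuousAt (fun t => log (2 * cos t)) (π / 4) :=
  ContinuousAt.log (by fun_prop) (by rw [cos_pi_div_four]; positivity)

theorem integral_sq_Ioo_zero_pi_div_four :
    HasIntegralOn (fun t => t ^ 2) (Ioo 0 (π / 4)) (π ^ 3 / 192) := by
  refine (hasIntegralOn_Ioo_of_hasDerivAt_Icc (f := fun t => t ^ 3 / 3) (by positivity)
    (fun t _ => ?_) (by fun_prop)).of_eq (by ring)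
  exact ((hasDerivAt_pow 3 t).div_const 3).congr_deriv (by norm_num)

theorem integrableOn_div_sin_mul_cos :
    IntegrableOn (fun t => t / (sin t * cos t)) (Ioo 0 (π / 4)) := by
  refine integrableOn_of_abs_le_log_sq (by fun_prop) 4 fun t ht => ?_
  have h1 := half_le_sin ht
  have h2 := half_le_cos ht
  have h3 := ht.1
  have h4 : t / 4 ≤ sin t * cos t := by nlinarith
  rw [abs_of_nonneg (div_nonneg h3.le (by linarith)), div_le_iff₀ (by linarith)]
  nlinarith [sq_nonneg (|log t|), abs_nonneg (log t)]

/-- Integration by parts of `t d(log tan t)`. -/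
theorem integral_div_sin_mul_cos : HasIntegralOn (fun t => t / (sin t * cos t)) (Ioo 0 (π / 4))
    (-2 * ∫ t in Ioo 0 (π / 4), log (2 * sin t)) := by
  have h1 := hasIntegralOn_self integrableOn_div_sin_mul_cos
  have h2 := (hasIntegralOn_self integrableOn_log_sin).sub (hasIntegralOn_self integrableOn_log_cos)
  have h3 := integral_log_sin_add_integral_log_cos
  have h4 := hasIntegralOn_Ioo_of_hasDerivAt (show 0 < π / 4 by positivity)
    (f := fun t => t * (log (2 * sin t) - log (2 * cos t)))
    (f' := fun t => log (2 * sin t) - log (2 * cos t) + t / (sin t * cos t)) (u := 0) (v := 0)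
    (fun t ht => by
      have hc := (cos_pos_of_mem_Ioo_pi_div_four ht)
      have hs := (sin_pos_of_mem_Ioo_pi_div_four ht)
      refine ((hasDerivAt_id' t).fun_mul
        ((hasDerivAt_log_two_mul_sin ht).fun_sub (hasDerivAt_log_two_mul_cos hc.ne'))).congr_deriv
          ?_
      field_simp
      linear_combination t * sin_sq_add_cos_sq t)
    (h2.add h1).1
    (tendsto_mul_of_abs_le_log_sq 3 fun t ht => by
      have h5 := abs_log_two_mul_sin_le ht
      have h6 := abs_log_two_mul_cos_le (Ioo_subset_Icc_self ht)
      have h7 := abs_sub (log (2 * sin t)) (log (2 * cos t))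
      nlinarith [abs_nonneg (log t)])
    (by
      have := (continuousAt_id.mul (continuousAt_log_two_mul_sin_pi_div_four.sub
        continuousAt_log_two_mul_cos_pi_div_four)).tendsto.mono_left (nhdsWithin_le_nhds (s :=
          Iio (π / 4)))
      simp only [Pi.mul_apply, Pi.sub_apply, log_two_mul_sin_pi_div_four,
        log_two_mul_cos_pi_div_four, sub_self, mul_zero] at this
      exact this)
  have h5 := h4.unique (h2.add h1)
  exact h1.of_eq (by linarith)

/-- The contour identity for `log (1 + y ^ 2) * arctan y / y`, on `(0, π / 4)`. -/
theorem integral_mul_log_cos_div_sin_mul_cos :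
    HasIntegralOn (fun t => t * log (2 * cos t) / (sin t * cos t)) (Ioo 0 (π / 4))
      (-2 * log 2 * (∫ t in Ioo 0 (π / 4), log (2 * sin t)) + π ^ 3 / 192 -
        ∫ t in Ioo 0 (π / 4), log (2 * cos t) ^ 2) := by
  obtain ⟨h1, h2, h3⟩ := integral_log_cos_sq_sub_sq
  have h4 := (hasIntegralOn_self h1).comp_tan
  have h5 : HasIntegralOn _ _ _ := ⟨h2, h3⟩
  rw [show π / 2 = 2 * (π / 4) by ring] at h5
  have h6 := h5.comp_two_mul
  have h7 := ((hasIntegralOn_self integrableOn_log_cos_sq).sub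
    integral_sq_Ioo_zero_pi_div_four).congr measurableSet_Ioo
    (g := fun t => log (2 * cos (2 * t / 2)) ^ 2 - (2 * t / 2) ^ 2) (fun t ht => by
      rw [show 2 * t / 2 = t by ring]) rfl
  have h8 := h6.unique h7
  refine ((integral_div_sin_mul_cos.const_mul (log 2)).sub (h4.const_mul (1 / 2))).congr
    measurableSet_Ioo (fun t ht => ?_) (by linarith)
  have hc := (cos_pos_of_mem_Ioo_pi_div_four ht)
  have hs := (sin_pos_of_mem_Ioo_pi_div_four ht)
  have e1 : 1 + tan t ^ 2 = (cos t ^ 2)⁻¹ := by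
    rw [← inv_one_add_tan_sq hc.ne', inv_inv]
  rw [e1, arctan_tan (by linarith [ht.1, pi_pos]) (by linarith [ht.2, pi_pos]), log_inv, log_pow,
    log_mul two_ne_zero hc.ne', tan_eq_sin_div_cos]
  push_cast
  field_simp
  ring

theorem integrableOn_log_sin_mul_log_cos :
    IntegrableOn (fun t => log (2 * sin t) * log (2 * cos t)) (Ioo 0 (π / 4)) := by
  have h := ((hasIntegralOn_self integrableOn_log_sin_sq).add
    (hasIntegralOn_self integrableOn_log_cos_sq)).sub integral_log_tan_sq
  exact ((h.const_mul (1 / 2)).congr measurableSet_Ioo (fun t ht => by rw [log_tan ht]; ring) rfl).1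

theorem integral_log_sin_mul_log_cos :
    ∫ t in Ioo 0 (π / 4), log (2 * sin t) * log (2 * cos t) = -π ^ 3 / 96 := by
  have h := ((hasIntegralOn_self integrableOn_log_sin_sq).add
    (hasIntegralOn_self integrableOn_log_cos_sq)).sub integral_log_tan_sq
  rw [((h.const_mul (1 / 2)).congr measurableSet_Ioo (fun t ht => by rw [log_tan ht]; ring) rfl).2,
    integral_log_sin_sq_add_integral_log_cos_sq]
  ring

theorem integral_log_mul_arctan_eq :
    ∫ y in Ioo (0 : ℝ) 1, log y * arctan y * (1 - y ^ 2) / (y * (1 + y ^ 2)) =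
      4 * (∫ t in Ioo 0 (π / 4), log (2 * cos t) ^ 2) +
        4 * log 2 * (∫ t in Ioo 0 (π / 4), log (2 * sin t)) - π ^ 3 / 48 := by
  have hP := (hasIntegralOn_self integral_sq_mul_cot_mul_log_tan.1).comp_tan
  have hA := hasIntegralOn_self integrableOn_log_sin_sq
  have hB := hasIntegralOn_self integrableOn_log_cos_sq
  have hAB := integral_log_sin_sq_add_integral_log_cos_sq
  have hG := (((hA.sub hB).sub (integral_log_tan_sq.const_mul (1 / 2))).add hP).add
    (integral_mul_log_cos_div_sin_mul_cos.const_mul 2)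
  have h4 := hasIntegralOn_Ioo_of_hasDerivAt (show 0 < π / 4 by positivity)
    (f := fun t => t * (1 / 2 * (log (2 * sin t) ^ 2 + 2 * (log (2 * sin t) * log (2 * cos t)) -
      3 * log (2 * cos t) ^ 2))) (u := 0) (v := 0)
    (fun t ht => by
      have hc := (cos_pos_of_mem_Ioo_pi_div_four ht)
      have hs := (sin_pos_of_mem_Ioo_pi_div_four ht)
      have d1 := hasDerivAt_log_two_mul_sin ht
      have d2 := hasDerivAt_log_two_mul_cos hc.ne'
      refine ((hasDerivAt_id' t).fun_mul ((((d1.fun_pow 2).fun_add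
        ((d1.fun_mul d2).const_mul 2)).fun_sub
        ((d2.fun_pow 2).const_mul 3)).const_mul (1 / 2))).congr_deriv ?_
      rw [arctan_tan (by linarith [ht.1, pi_pos]) (by linarith [ht.2, pi_pos]), log_tan ht,
        tan_eq_sin_div_cos]
      have e : 1 + (sin t / cos t) ^ 2 = 1 / cos t ^ 2 := by
        field_simp
        linear_combination sin_sq_add_cos_sq t
      rw [e]
      generalize log (2 * sin t) = s
      generalize log (2 * cos t) = c
      field_simp
      have h1 := sin_sq_add_cos_sq t
      have h2 : cos t ^ 2 = 1 - sin t ^ 2 := by linarith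
      push_cast
      simp only [h2]
      ring)
    hG.1
    (tendsto_mul_of_abs_le_log_sq 3 fun t ht => by
      have h5 := abs_log_two_mul_sin_le ht
      have h6 := abs_log_two_mul_cos_le (Ioo_subset_Icc_self ht)
      have h7 := abs_nonneg (log t)
      generalize |log t| = L at *
      generalize log (2 * sin t) = s at *
      generalize log (2 * cos t) = c at *
      rw [abs_le] at h5 h6 ⊢
      have e1 : s ^ 2 ≤ (L + 1) ^ 2 := sq_le_sq' h5.1 h5.2
      have e2 : c ^ 2 ≤ 1 := by nlinarith
      constructor
      · nlinarith [sq_nonneg (s + c)]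
      · nlinarith [sq_nonneg (s - c)])
    (by
      have hs := continuousAt_log_two_mul_sin_pi_div_four
      have hc := continuousAt_log_two_mul_cos_pi_div_four
      have h : ContinuousAt (fun t => t * (1 / 2 * (log (2 * sin t) ^ 2 +
        2 * (log (2 * sin t) * log (2 * cos t)) - 3 * log (2 * cos t) ^ 2))) (π / 4) := by fun_prop
      have := h.tendsto.mono_left (nhdsWithin_le_nhds (s := Iio (π / 4)))
      rw [log_two_mul_sin_pi_div_four, log_two_mul_cos_pi_div_four] at this
      convert this using 2
      ring)
  have h5 := h4.unique hG
  linarith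

theorem integral_tan : HasIntegralOn tan (Ioo 0 (π / 4)) (log 2 / 2) := by
  have hc : ∀ t ∈ Icc 0 (π / 4), cos t ≠ 0 := fun t ht =>
    (cos_pos_of_mem_Ioo ⟨by linarith [ht.1, pi_pos], by linarith [ht.2, pi_pos]⟩).ne'
  refine (hasIntegralOn_Ioo_of_hasDerivAt_Icc (f := fun t => -log (2 * cos t)) (f' := tan)
    (by positivity)
    (fun t ht => (hasDerivAt_log_two_mul_cos (hc t ht)).fun_neg.congr_deriv ?_)
    (fun t ht => (continuousAt_tan.2 (hc t ht)).continuousWithinAt)).of_eq ?_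
  · rw [neg_neg, tan_eq_sin_div_cos]
  · rw [log_two_mul_cos_pi_div_four]; simp; ring

theorem integral_tan_mul_log_cos :
    HasIntegralOn (fun t => tan t * log (2 * cos t)) (Ioo 0 (π / 4)) (3 * log 2 ^ 2 / 8) := by
  have hc : ∀ t ∈ Icc 0 (π / 4), cos t ≠ 0 := fun t ht =>
    (cos_pos_of_mem_Ioo ⟨by linarith [ht.1, pi_pos], by linarith [ht.2, pi_pos]⟩).ne'
  refine (hasIntegralOn_Ioo_of_hasDerivAt_Icc (f := fun t => -log (2 * cos t) ^ 2 / 2)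
    (by positivity)
    (fun t ht => (((hasDerivAt_log_two_mul_cos (hc t ht)).fun_pow 2).fun_neg.div_const
      2).congr_deriv ?_)
    (ContinuousOn.mul (fun t ht => (continuousAt_tan.2 (hc t ht)).continuousWithinAt)
      continuousOn_log_cos)).of_eq ?_
  · rw [Pi.mul_apply, tan_eq_sin_div_cos]; push_cast; ring
  · rw [log_two_mul_cos_pi_div_four]; simp; ring

theorem integral_tan_mul_log_sin :
    HasIntegralOn (fun t => tan t * log (2 * sin t)) (Ioo 0 (π / 4))
      (3 * log 2 ^ 2 / 8 - π ^ 2 / 48) :=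
  (integral_tan_mul_log_tan.add integral_tan_mul_log_cos).congr measurableSet_Ioo
    (fun t ht => by rw [log_tan ht]; ring) (by ring)

theorem integrableOn_mul_tan_mul_log_sin :
    IntegrableOn (fun t => t * (tan t * (log (2 * sin t) - log 2 / 2))) (Ioo 0 (π / 4)) := by
  refine integrableOn_of_abs_le_log_sq (by simp only [tan_eq_sin_div_cos]; fun_prop) 2 fun t ht =>
    ?_
  have h5 := abs_log_two_mul_sin_le ht
  have h1 : |tan t| ≤ 1 := by
    have := (image_tan_Ioo_zero_pi_div_four ▸ mem_image_of_mem tan ht : tan t ∈ Ioo 0 1)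
    rw [abs_of_pos this.1]; exact this.2.le
  have h2 : |t| ≤ 1 := by rw [abs_of_pos ht.1]; linarith [ht.2, pi_lt_four]
  have h3 : |log (2 * sin t) - log 2 / 2| ≤ |log t| + 2 := by
    have := abs_sub (log (2 * sin t)) (log 2 / 2)
    have h6 : |log 2 / 2| ≤ 1 := by
      rw [abs_of_nonneg (by positivity)]; linarith [log_two_lt_d9]
    linarith
  rw [abs_mul, abs_mul]
  calc |t| * (|tan t| * |log (2 * sin t) - log 2 / 2|) ≤ 1 * (1 * (|log t| + 2)) := by gcongr
    _ ≤ _ := by nlinarith [abs_nonneg (log t)]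

theorem integral_mul_tan_mul_log_sin :
    ∫ t in Ioo 0 (π / 4), t * (tan t * (log (2 * sin t) - log 2 / 2)) =
      -π ^ 3 / 192 + π * log 2 ^ 2 / 32 - 3 / 2 * (∫ t in Ioo 0 (π / 4), log (2 * cos t) ^ 2) -
        3 / 2 * log 2 * (∫ t in Ioo 0 (π / 4), log (2 * sin t)) := by
  have hself := hasIntegralOn_self integrableOn_mul_tan_mul_log_sin
  have hs := hasIntegralOn_self integrableOn_log_sin
  have hc := hasIntegralOn_self integrableOn_log_cos
  have hsc := (hasIntegralOn_self integrableOn_log_sin_mul_log_cos).of_eq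
    integral_log_sin_mul_log_cos
  have hcc := hasIntegralOn_self integrableOn_log_cos_sq
  have h1 : HasIntegralOn (fun _ => (1 : ℝ)) (Ioo 0 (π / 4)) (π / 4) :=
    ⟨integrableOn_const (by simp), by simp; positivity⟩
  have h0 := integral_log_sin_add_integral_log_cos
  have hG := (((hsc.sub ((hs.add hc).const_mul (log 2 / 2))).sub
    ((hcc.sub (hc.const_mul (log 2))).const_mul (1 / 2))).add (h1.const_mul (log 2 ^ 2 / 8))).add
    ((integral_mul_log_cos_div_sin_mul_cos.sub (integral_div_sin_mul_cos.const_mul (log 2 / 2))).sub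
      hself)
  have h4 := hasIntegralOn_Ioo_of_hasDerivAt (show 0 < π / 4 by positivity)
    (f := fun t => t * ((log (2 * sin t) - log 2 / 2) * (log (2 * cos t) - log 2 / 2) -
      1 / 2 * (log (2 * cos t) - log 2 / 2) ^ 2)) (u := 0) (v := 0)
    (fun t ht => by
      have hc := (cos_pos_of_mem_Ioo_pi_div_four ht)
      have hs := (sin_pos_of_mem_Ioo_pi_div_four ht)
      have d1 := (hasDerivAt_log_two_mul_sin ht).sub_const (log 2 / 2)
      have d2 := (hasDerivAt_log_two_mul_cos hc.ne').sub_const (log 2 / 2)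
      refine ((hasDerivAt_id' t).fun_mul ((d1.fun_mul d2).fun_sub
        ((d2.fun_pow 2).const_mul (1 / 2)))).congr_deriv ?_
      rw [tan_eq_sin_div_cos]
      generalize log (2 * sin t) = s
      generalize log (2 * cos t) = c
      have h2 : cos t / sin t = 1 / (sin t * cos t) - sin t / cos t := by
        field_simp
        linear_combination sin_sq_add_cos_sq t
      rw [h2]
      push_cast
      ring)
    hG.1
    (tendsto_mul_of_abs_le_log_sq 6 fun t ht => by
      have h5 := abs_log_two_mul_sin_le ht
      have h6 := abs_log_two_mul_cos_le (Ioo_subset_Icc_self ht)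
      have h7 := abs_nonneg (log t)
      have h8 := log_two_lt_d9
      have h9 : 0 < log 2 := by positivity
      generalize |log t| = L at *
      generalize log (2 * sin t) = s at *
      generalize log (2 * cos t) = c at *
      generalize log 2 = l at *
      have e1 : |s - l / 2| ≤ 2 * (L + 1) := by
        rw [abs_le] at h5 ⊢
        constructor <;> linarith
      have e2 : |c - l / 2| ≤ 2 := by
        rw [abs_le] at h6 ⊢
        constructor <;> linarith
      calc |(s - l / 2) * (c - l / 2) - 1 / 2 * (c - l / 2) ^ 2|
          ≤ |s - l / 2| * |c - l / 2| + 1 / 2 * |c - l / 2| ^ 2 := by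
            refine (abs_sub _ _).trans_eq ?_
            rw [abs_mul, abs_mul, abs_pow, abs_of_pos (show (0 : ℝ) < 1 / 2 by norm_num)]
        _ ≤ 2 * (L + 1) * 2 + 1 / 2 * 2 ^ 2 := by gcongr
        _ ≤ _ := by nlinarith)
    (by
      have hs := continuousAt_log_two_mul_sin_pi_div_four
      have hc := continuousAt_log_two_mul_cos_pi_div_four
      have h : ContinuousAt (fun t => t * ((log (2 * sin t) - log 2 / 2) *
        (log (2 * cos t) - log 2 / 2) - 1 / 2 * (log (2 * cos t) - log 2 / 2) ^ 2)) (π / 4) := by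
        fun_prop
      have := h.tendsto.mono_left (nhdsWithin_le_nhds (s := Iio (π / 4)))
      rw [log_two_mul_sin_pi_div_four, log_two_mul_cos_pi_div_four] at this
      convert this using 2
      ring)
  have h5 := h4.unique hG
  have h6 : (∫ t in Ioo 0 (π / 4), log (2 * cos t)) = -∫ t in Ioo 0 (π / 4), log (2 * sin t) := by
    linarith
  rw [h6] at h5
  linarith

/-- The imaginary part of the integral representing `Li₃((1 + i) / 2)`. -/
theorem integral_im_polylog_three :
    HasIntegralOn (fun t => 1 / 2 * ((log (2 * sin t) - log 2 / 2) ^ 2 - (π / 4 - t) ^ 2) +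
        (π / 4 - t) * (tan t * (log (2 * sin t) - log 2 / 2))) (Ioo 0 (π / 4))
      ((∫ t in Ioo 0 (π / 4), log (2 * cos t) ^ 2) +
        log 2 * (∫ t in Ioo 0 (π / 4), log (2 * sin t)) + 7 * π ^ 3 / 384 + π * log 2 ^ 2 / 32)
          := by
  have hself := (hasIntegralOn_self integrableOn_mul_tan_mul_log_sin).of_eq
    integral_mul_tan_mul_log_sin
  have hs := hasIntegralOn_self integrableOn_log_sin
  have hss := hasIntegralOn_self integrableOn_log_sin_sq
  have h1 : HasIntegralOn (fun _ => (1 : ℝ)) (Ioo 0 (π / 4)) (π / 4) :=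
    ⟨integrableOn_const (by simp), by simp; positivity⟩
  have h2 : HasIntegralOn (fun t => (π / 4 - t) ^ 2) (Ioo 0 (π / 4)) (π ^ 3 / 192) :=
    HasIntegralOn.comp_sub_left (g := fun t => t ^ 2)
      (by simpa using integral_sq_Ioo_zero_pi_div_four)
  have hAB := integral_log_sin_sq_add_integral_log_cos_sq
  refine ((((hss.sub (hs.const_mul (log 2))).add (h1.const_mul (log 2 ^ 2 / 4))).sub h2).const_mul
    (1 / 2)).add (((integral_tan_mul_log_sin.sub (integral_tan.const_mul (log 2 / 2))).const_mul
      (π / 4)).sub hself) |>.congr measurableSet_Ioo (fun t ht => by ring) ?_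
  linear_combination (-1 / 2) * hAB

/-- The arc `t ↦ sin t * (sin t + i cos t)` from `0` to `(1 + i) / 2`. -/
noncomputable def polylogPath (t : ℝ) : ℂ := (sin t : ℂ) * ((sin t : ℂ) + (cos t : ℂ) * Complex.I)

/-- The derivative of `polylogPath`. -/
noncomputable def polylogPathDeriv (t : ℝ) : ℂ :=
  ((2 * (sin t * cos t) : ℝ) : ℂ) + ((cos t ^ 2 - sin t ^ 2 : ℝ) : ℂ) * Complex.I

/-- The logarithm of `polylogPath t / polylogPath (π / 4)`. -/
noncomputable def logPath (t : ℝ) : ℂ :=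
  ((log (2 * sin t) - log 2 / 2 : ℝ) : ℂ) + ((π / 4 - t : ℝ) : ℂ) * Complex.I

theorem norm_polylogPath (t : ℝ) : ‖polylogPath t‖ = |sin t| := by
  rw [polylogPath, norm_mul, Complex.norm_add_mul_I, sin_sq_add_cos_sq, sqrt_one, mul_one,
    Complex.norm_real, norm_eq_abs]

theorem norm_polylogPathDeriv (t : ℝ) : ‖polylogPathDeriv t‖ = 1 := by
  rw [polylogPathDeriv, Complex.norm_add_mul_I, sqrt_eq_one]
  linear_combination (sin t ^ 2 + cos t ^ 2 + 1) * sin_sq_add_cos_sq t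

theorem hasDerivAt_polylogPath (t : ℝ) : HasDerivAt polylogPath (polylogPathDeriv t) t := by
  have hs := (hasDerivAt_sin t).ofReal_comp
  have hc := (hasDerivAt_cos t).ofReal_comp
  refine (hs.fun_mul (hs.fun_add (hc.mul_const Complex.I))).congr_deriv ?_
  simp only [polylogPathDeriv]
  push_cast
  ring

theorem hasDerivAt_logPath {t : ℝ} (ht : t ∈ Ioo 0 (π / 4)) :
    HasDerivAt logPath (((cos t / sin t : ℝ) : ℂ) - Complex.I) t := by
  have hs := ((hasDerivAt_log_two_mul_sin ht).sub_const (log 2 / 2)).ofReal_comp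
  have hc := ((hasDerivAt_id' t).const_sub (π / 4)).ofReal_comp
  refine (hs.fun_add (hc.mul_const Complex.I)).congr_deriv ?_
  push_cast
  ring

theorem polylogPath_mul_deriv_logPath {t : ℝ} (ht : t ∈ Ioo 0 (π / 4)) :
    polylogPath t * (((cos t / sin t : ℝ) : ℂ) - Complex.I) = polylogPathDeriv t := by
  have hs : (sin t : ℂ) ≠ 0 := by exact_mod_cast (sin_pos_of_mem_Ioo_pi_div_four ht).ne'
  simp only [polylogPath, polylogPathDeriv]
  push_cast at hs ⊢
  field_simp
  ring_nf
  simp only [Complex.I_sq]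
  ring

theorem norm_logPath_sq_le {t : ℝ} (ht : t ∈ Ioo 0 (π / 4)) :
    ‖logPath t‖ ^ 2 ≤ 4 * (|log t| + 1) ^ 2 := by
  rw [logPath, Complex.norm_add_mul_I, sq_sqrt (by positivity)]
  have h := abs_le.1 (abs_log_two_mul_sin_le ht)
  have h1 := log_two_lt_d9
  have h2 : 0 < log 2 := log_pos (by norm_num)
  have h3 : |log (2 * sin t) - log 2 / 2| ≤ 3 / 2 * (|log t| + 1) := by
    rw [abs_le]
    constructor <;> linarith [abs_nonneg (log t), h.1, h.2]
  have h4 := sq_le_sq' (abs_le.1 h3).1 (abs_le.1 h3).2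
  have h5 : (π / 4 - t) ^ 2 ≤ 1 := by
    nlinarith [ht.1, ht.2, pi_lt_four]
  nlinarith [abs_nonneg (log t)]

theorem one_sub_polylogPath_inv {t : ℝ} (ht : t ∈ Ioo 0 (π / 4)) :
    (1 - polylogPath t)⁻¹ * polylogPathDeriv t = (tan t : ℂ) + Complex.I := by
  have hc : (cos t : ℂ) ≠ 0 := by exact_mod_cast (cos_pos_of_mem_Ioo_pi_div_four ht).ne'
  have h1 : 1 - polylogPath t ≠ 0 := by
    intro h
    have h0 := norm_polylogPath t
    rw [← sub_eq_zero.1 h, norm_one, abs_of_pos (sin_pos_of_mem_Ioo_pi_div_four ht)] at h0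
    nlinarith [sin_sq_add_cos_sq t, cos_pos_of_mem_Ioo_pi_div_four ht]
  have h2 : (sin t : ℂ) ^ 2 + (cos t : ℂ) ^ 2 = 1 := by exact_mod_cast sin_sq_add_cos_sq t
  rw [inv_mul_eq_div, div_eq_iff h1, tan_eq_sin_div_cos]
  simp only [polylogPath, polylogPathDeriv]
  push_cast at hc h2 ⊢
  field_simp
  linear_combination ((Complex.sin t) + (Complex.cos t) * Complex.I) * h2 +
    (Complex.cos t ^2 * Complex.sin t) * Complex.I_sq

theorem polylogPath_pi_div_four : polylogPath (π / 4) = (1 + Complex.I) / 2 := by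
  have h : ((√2 : ℝ) : ℂ) ^ 2 = 2 := by exact_mod_cast sq_sqrt (zero_le_two)
  rw [polylogPath, sin_pi_div_four, cos_pi_div_four]
  push_cast
  linear_combination (1 + Complex.I) / 4 * h

theorem logPath_pi_div_four : logPath (π / 4) = 0 := by
  rw [logPath, log_two_mul_sin_pi_div_four]
  simp

theorem measurable_logPath : Measurable logPath := by
  unfold logPath
  fun_prop

theorem continuous_polylogPath : Continuous polylogPath := by
  unfold polylogPath
  fun_prop

theorem continuous_polylogPathDeriv : Continuous polylogPathDeriv := by
  unfold polylogPathDeriv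
  fun_prop

theorem norm_polylogPath_le {t : ℝ} (ht : t ∈ Ioo 0 (π / 4)) : ‖polylogPath t‖ ≤ √2 / 2 := by
  rw [norm_polylogPath, abs_of_pos (sin_pos_of_mem_Ioo_pi_div_four ht), ← sin_pi_div_four]
  exact (sin_lt_sin_of_lt_of_le_pi_div_two (by linarith [ht.1, pi_pos]) (by linarith [pi_pos])
    ht.2).le

theorem sqrt_two_div_two_lt_one : √2 / 2 < 1 := by
  rw [div_lt_one two_pos, sqrt_lt' two_pos]
  norm_num

theorem norm_logPath_integrand_le (n : ℕ) {t : ℝ} (ht : t ∈ Ioo 0 (π / 4)) :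
    ‖1 / 2 * logPath t ^ 2 * polylogPath t ^ n * polylogPathDeriv t‖ ≤
      (√2 / 2) ^ n * (2 * (|log t| + 1) ^ 2) := by
  rw [norm_mul, norm_mul, norm_mul, norm_pow, norm_pow, norm_polylogPathDeriv, mul_one, mul_comm]
  have := norm_logPath_sq_le ht
  refine mul_le_mul (pow_le_pow_left₀ (norm_nonneg _) (norm_polylogPath_le ht) n) ?_
    (by positivity) (by positivity)
  norm_num
  linarith

theorem integral_logPath_sq_mul_pow (n : ℕ) :
    HasIntegralOn (fun t => 1 / 2 * logPath t ^ 2 * polylogPath t ^ n * polylogPathDeriv t)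
      (Ioo 0 (π / 4)) (((1 + Complex.I) / 2) ^ (n + 1) / ((n + 1 : ℕ) : ℂ) ^ 3) := by
  have hN : ((n : ℂ) + 1) ≠ 0 := by exact_mod_cast n.succ_ne_zero
  have hp : 0 < π / 4 := by positivity
  refine (hasIntegralOn_Ioo_of_hasDerivAt (f := fun t => polylogPath t ^ (n + 1) *
      (logPath t ^ 2 / (2 * (n + 1)) - logPath t / (n + 1) ^ 2 + 1 / (n + 1) ^ 3))
    (u := 0) (v := ((1 + Complex.I) / 2) ^ (n + 1) / ((n + 1 : ℕ) : ℂ) ^ 3) hp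
    (fun t ht => ?_) ?_ ?_ ?_).of_eq (sub_zero _)
  · have h1 := hasDerivAt_polylogPath t
    have h2 := hasDerivAt_logPath ht
    refine ((h1.fun_pow (n + 1)).fun_mul ((((h2.fun_pow 2).div_const (2 * (n + 1) : ℂ)).fun_sub
      (h2.div_const ((n + 1 : ℂ) ^ 2))).add_const (1 / (n + 1 : ℂ) ^ 3))).congr_deriv ?_
    rw [← polylogPath_mul_deriv_logPath ht, Nat.add_sub_cancel]
    generalize ((cos t / sin t : ℝ) : ℂ) - Complex.I = l
    push_cast
    field_simp
    ring
  · refine ((integrableOn_abs_log_add_one_sq.const_mul 2).const_mul ((√2 / 2) ^ n)).mono'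
      (((((measurable_logPath.pow_const 2).const_mul (1 / 2)).mul
        (continuous_polylogPath.measurable.pow_const n)).mul
        continuous_polylogPathDeriv.measurable).aestronglyMeasurable) ?_
    exact (ae_restrict_iff' measurableSet_Ioo).2
      (Eventually.of_forall fun t ht => norm_logPath_integrand_le n ht)
  · have h0 := tendsto_mul_abs_log_add_one_sq.const_mul 6
    rw [mul_zero] at h0
    refine squeeze_zero_norm' ?_ h0
    filter_upwards [Ioo_mem_nhdsGT hp] with t ht
    have hs := sin_pos_of_mem_Ioo_pi_div_four ht
    have h1 : ‖polylogPath t ^ (n + 1)‖ ≤ t := by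
      rw [norm_pow, norm_polylogPath, abs_of_pos hs, pow_succ]
      exact (mul_le_of_le_one_left hs.le (pow_le_one₀ hs.le (sin_le_one t))).trans
        (sin_le ht.1.le)
    have hn : (1 : ℝ) ≤ ‖(n : ℂ) + 1‖ := by
      have : ((n : ℂ) + 1) = ((n + 1 : ℕ) : ℂ) := by push_cast; rfl
      rw [this, Complex.norm_natCast]
      exact_mod_cast Nat.succ_le_succ n.zero_le
    have h2 : ‖logPath t ^ 2 / (2 * ((n : ℂ) + 1)) - logPath t / ((n : ℂ) + 1) ^ 2 +
        1 / ((n : ℂ) + 1) ^ 3‖ ≤ 6 * (|log t| + 1) ^ 2 := by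
      have hl := norm_logPath_sq_le ht
      have a1 : ‖logPath t ^ 2 / (2 * ((n : ℂ) + 1))‖ ≤ ‖logPath t‖ ^ 2 / 2 := by
        rw [norm_div, norm_mul, norm_pow, Complex.norm_ofNat]
        exact div_le_div_of_nonneg_left (by positivity) two_pos (by linarith)
      have a2 : ‖logPath t / ((n : ℂ) + 1) ^ 2‖ ≤ ‖logPath t‖ := by
        rw [norm_div, norm_pow]
        exact div_le_self (norm_nonneg _) (one_le_pow₀ hn)
      have a3 : ‖1 / ((n : ℂ) + 1) ^ 3‖ ≤ 1 := by
        rw [norm_div, norm_pow, norm_one]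
        exact div_le_self zero_le_one (one_le_pow₀ hn)
      have a4 := norm_add_le (logPath t ^ 2 / (2 * ((n : ℂ) + 1)) - logPath t / ((n : ℂ) + 1) ^ 2)
        (1 / ((n : ℂ) + 1) ^ 3)
      have a5 := norm_sub_le (logPath t ^ 2 / (2 * ((n : ℂ) + 1))) (logPath t / ((n : ℂ) + 1) ^ 2)
      nlinarith [sq_nonneg (‖logPath t‖ - 1), abs_nonneg (log t)]
    rw [norm_mul]
    calc _ ≤ t * (6 * (|log t| + 1) ^ 2) := mul_le_mul h1 h2 (norm_nonneg _) ht.1.le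
      _ = _ := by ring
  · have hl : ContinuousAt logPath (π / 4) :=
      (Complex.continuous_ofReal.continuousAt.comp
        (continuousAt_log_two_mul_sin_pi_div_four.sub continuousAt_const)).add
        (Continuous.continuousAt (by fun_prop))
    have hf : ContinuousAt (fun t => polylogPath t ^ (n + 1) * (logPath t ^ 2 / (2 * (n + 1)) -
        logPath t / (n + 1) ^ 2 + 1 / (n + 1) ^ 3)) (π / 4) :=
      (continuous_polylogPath.continuousAt.pow (n + 1)).mul
        ((((hl.pow 2).div_const (2 * (n + 1) : ℂ)).sub (hl.div_const ((n + 1 : ℂ) ^ 2))).add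
          (continuousAt_const (y := 1 / (n + 1 : ℂ) ^ 3)))
    convert hf.tendsto.mono_left (nhdsWithin_le_nhds (s := Iio (π / 4))) using 2
    rw [logPath_pi_div_four, polylogPath_pi_div_four]
    push_cast
    ring

theorem cpolylog_three_eq_integral :
    HasIntegralOn (fun t => 1 / 2 * logPath t ^ 2 * ((tan t : ℂ) + Complex.I)) (Ioo 0 (π / 4))
      (cpolylog 3 ((1 + Complex.I) / 2)) := by
  have hc : Summable fun n : ℕ => (√2 / 2) ^ n * ∫ t in Ioo 0 (π / 4), 2 * (|log t| + 1) ^ 2 :=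
    (summable_geometric_of_lt_one (by positivity) sqrt_two_div_two_lt_one).mul_right
      (∫ t in Ioo 0 (π / 4), 2 * (|log t| + 1) ^ 2)
  have hle (n : ℕ) : ∫ t in Ioo 0 (π / 4),
      ‖1 / 2 * logPath t ^ 2 * polylogPath t ^ n * polylogPathDeriv t‖ ≤
      (√2 / 2) ^ n * ∫ t in Ioo 0 (π / 4), 2 * (|log t| + 1) ^ 2 := by
    rw [← integral_const_mul]
    have hb : IntegrableOn (fun t => (√2 / 2) ^ n * (2 * (|log t| + 1) ^ 2)) (Ioo 0 (π / 4)) :=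
      (integrableOn_abs_log_add_one_sq.const_mul 2).const_mul _
    exact setIntegral_mono_on (integral_logPath_sq_mul_pow n).1.norm hb measurableSet_Ioo
      fun t ht => norm_logPath_integrand_le n ht
  have hF (t : ℝ) (ht : t ∈ Ioo 0 (π / 4)) :
      HasSum (fun n => 1 / 2 * logPath t ^ 2 * polylogPath t ^ n * polylogPathDeriv t)
        (1 / 2 * logPath t ^ 2 * ((tan t : ℂ) + Complex.I)) := by
    rw [← one_sub_polylogPath_inv ht, ← mul_assoc]
    exact ((hasSum_geometric_of_norm_lt_one
      ((norm_polylogPath_le ht).trans_lt sqrt_two_div_two_lt_one)).mul_left _).mul_right _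
  obtain ⟨h1, h2⟩ := integrable_and_hasSum_integral measurableSet_Ioo
    (fun n => (integral_logPath_sq_mul_pow n).1) hle hc hF
  refine ⟨h1, ?_⟩
  rw [cpolylog, ← h2.tsum_eq]
  exact tsum_congr fun n => (integral_logPath_sq_mul_pow n).2

theorem im_half_mul_sq_mul (a b c : ℝ) :
    (1 / 2 * ((a : ℂ) + (b : ℂ) * Complex.I) ^ 2 * ((c : ℂ) + Complex.I)).im =
      1 / 2 * (a ^ 2 - b ^ 2) + b * (c * a) := by
  have h : (1 / 2 * ((a : ℂ) + (b : ℂ) * Complex.I) ^ 2 * ((c : ℂ) + Complex.I)) =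
      ((1 / 2 * (a ^ 2 - b ^ 2) * c - a * b : ℝ) : ℂ) +
        ((1 / 2 * (a ^ 2 - b ^ 2) + b * (c * a) : ℝ) : ℂ) * Complex.I := by
    push_cast
    linear_combination ((c + Complex.I) * (b : ℂ) ^ 2 / 2 + a * b) * Complex.I_sq
  rw [h]
  simp only [Complex.add_im, Complex.ofReal_im, Complex.im_ofReal_mul, Complex.I_im]
  ring

theorem im_cpolylog_three :
    (cpolylog 3 ((1 + Complex.I) / 2)).im = (∫ t in Ioo 0 (π / 4), log (2 * cos t) ^ 2) +
      log 2 * (∫ t in Ioo 0 (π / 4), log (2 * sin t)) + 7 * π ^ 3 / 384 + π * log 2 ^ 2 / 32 := by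
  rw [← integral_im_polylog_three.2, ← cpolylog_three_eq_integral.2, ← Complex.imCLM_apply,
    ← Complex.imCLM.integral_comp_comm cpolylog_three_eq_integral.1]
  congr 1
  ext t
  exact im_half_mul_sq_mul _ _ _

theorem integral_log_mul_arctan_eq_im_cpolylog :
    ∫ y in Ioo 0 1, log y * arctan y * (1 - y ^ 2) / (y * (1 + y ^ 2)) =
      4 * (cpolylog 3 ((1 + Complex.I) / 2)).im - 3 * π ^ 3 / 32 - π * log 2 ^ 2 / 8 := by
  rw [integral_log_mul_arctan_eq, im_cpolylog_three]
  ring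

/-- The Wallis integral of an odd power of the sine. -/
noncomputable def oddWallis (n : ℕ) : ℝ := ∫ t in Ioo 0 (π / 2), sin t ^ (2 * n + 1)

theorem sin_pos_of_mem_Ioo_pi_div_two {t : ℝ} (ht : t ∈ Ioo 0 (π / 2)) : 0 < sin t :=
  sin_pos_of_pos_of_lt_pi ht.1 (by linarith [ht.2, pi_pos])

theorem cos_pos_of_mem_Ioo_pi_div_two {t : ℝ} (ht : t ∈ Ioo 0 (π / 2)) : 0 < cos t :=
  cos_pos_of_mem_Ioo ⟨by linarith [ht.1, pi_pos], ht.2⟩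

theorem hasIntegralOn_sin_pow_odd (n : ℕ) :
    HasIntegralOn (fun t => sin t ^ (2 * n + 1)) (Ioo 0 (π / 2)) (oddWallis n) :=
  ⟨integrableOn_Ioo_of_continuousOn_Icc (by fun_prop), rfl⟩

theorem oddWallis_nonneg (n : ℕ) : 0 ≤ oddWallis n :=
  setIntegral_nonneg measurableSet_Ioo fun _ ht =>
    pow_nonneg (sin_pos_of_mem_Ioo_pi_div_two ht).le _

theorem oddWallis_le (n : ℕ) : oddWallis n ≤ π / 2 := by
  have h : IntegrableOn (fun _ : ℝ => (1 : ℝ)) (Ioo 0 (π / 2)) := integrableOn_const (by simp)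
  refine (setIntegral_mono_on (hasIntegralOn_sin_pow_odd n).1 h measurableSet_Ioo
    fun t ht => pow_le_one₀ (sin_pos_of_mem_Ioo_pi_div_two ht).le (sin_le_one t)).trans_eq ?_
  simp
  positivity

theorem integral_sin_mul_sin_div {θ : ℝ} (hθ : θ ∈ Ioo 0 (π / 2)) :
    HasIntegralOn (fun t => sin θ * sin t / (1 - sin θ ^ 2 * sin t ^ 2)) (Ioo 0 (π / 2))
      (θ / cos θ) := by
  have hc := cos_pos_of_mem_Ioo_pi_div_two hθ
  have hs := sin_pos_of_mem_Ioo_pi_div_two hθ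
  have hpos (t : ℝ) : 0 < 1 - sin θ ^ 2 * sin t ^ 2 := by
    nlinarith [sin_sq_add_cos_sq θ, sin_sq_add_cos_sq t, sq_pos_of_pos hc, sq_nonneg (cos t),
      sq_nonneg (sin θ)]
  refine (hasIntegralOn_Ioo_of_hasDerivAt_Icc (f := fun t => -(arctan (tan θ * cos t) / cos θ))
    (by positivity) (fun t _ => ?_) ?_).of_eq ?_
  · refine ((((hasDerivAt_cos t).const_mul (tan θ)).arctan.div_const (cos θ)).fun_neg).congr_deriv
      ?_
    have h1 : 1 + (tan θ * cos t) ^ 2 = (1 - sin θ ^ 2 * sin t ^ 2) / cos θ ^ 2 := by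
      rw [tan_eq_sin_div_cos]
      field_simp
      linear_combination sin_sq_add_cos_sq θ + (sin θ ^ 2) * sin_sq_add_cos_sq t
    rw [h1, tan_eq_sin_div_cos]
    have := (hpos t).ne'
    field_simp
  · exact ContinuousOn.div (by fun_prop) (by fun_prop) fun t _ => (hpos t).ne'
  · simp only [cos_pi_div_two, mul_zero, arctan_zero, zero_div, cos_zero, mul_one]
    rw [arctan_tan (by linarith [hθ.1, pi_pos]) hθ.2]
    ring

theorem hasSum_oddWallis_mul_sin_pow {θ : ℝ} (hθ : θ ∈ Ioo 0 (π / 2)) :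
    HasSum (fun n => oddWallis n * sin θ ^ (2 * n + 1)) (θ / cos θ) := by
  have hc := cos_pos_of_mem_Ioo_pi_div_two hθ
  have hs := sin_pos_of_mem_Ioo_pi_div_two hθ
  have hlt : sin θ ^ 2 < 1 := by nlinarith [sin_sq_add_cos_sq θ]
  have hi (n : ℕ) : HasIntegralOn (fun t => sin θ ^ (2 * n + 1) * sin t ^ (2 * n + 1))
      (Ioo 0 (π / 2)) (sin θ ^ (2 * n + 1) * oddWallis n) :=
    (hasIntegralOn_sin_pow_odd n).const_mul _
  have hle (n : ℕ) : ∫ t in Ioo 0 (π / 2), ‖sin θ ^ (2 * n + 1) * sin t ^ (2 * n + 1)‖ ≤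
      (sin θ ^ 2) ^ n * (π / 2) := by
    have h1 : ∫ t in Ioo 0 (π / 2), ‖sin θ ^ (2 * n + 1) * sin t ^ (2 * n + 1)‖ =
        sin θ ^ (2 * n + 1) * oddWallis n := by
      rw [← (hi n).2]
      refine setIntegral_congr_fun measurableSet_Ioo fun t ht => ?_
      have := sin_pos_of_mem_Ioo_pi_div_two ht
      exact norm_of_nonneg (by positivity)
    rw [h1, pow_succ, pow_mul]
    exact mul_le_mul (mul_le_of_le_one_right (by positivity) (sin_le_one θ)) (oddWallis_le n)
      (oddWallis_nonneg n) (by positivity)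
  have h := integrable_and_hasSum_integral measurableSet_Ioo (fun n => (hi n).1) hle
    ((summable_geometric_of_lt_one (by positivity) hlt).mul_right (π / 2))
    (F := fun t => sin θ * sin t / (1 - sin θ ^ 2 * sin t ^ 2)) (fun t _ => by
      have h2 : sin θ ^ 2 * sin t ^ 2 < 1 := by
        nlinarith [sin_sq_le_one t, sq_nonneg (sin θ), sq_nonneg (sin t)]
      refine ((hasSum_geometric_of_lt_one (by positivity) h2).mul_left
        (sin θ * sin t)).congr_fun fun n => ?_
      ring)
  rw [(integral_sin_mul_sin_div hθ).2] at h
  exact h.2.congr_fun fun n => by rw [(hi n).2, mul_comm]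

theorem hasSum_oddWallis_mul_sin_pow_div {θ : ℝ} (hθ : θ ∈ Ioo 0 (π / 2)) :
    HasSum (fun n => oddWallis n / (n + 1) * sin θ ^ (2 * n + 2)) (θ ^ 2) := by
  have hc := cos_pos_of_mem_Ioo_pi_div_two hθ
  have hs := sin_pos_of_mem_Ioo_pi_div_two hθ
  have hlt : sin θ ^ 2 < 1 := by nlinarith [sin_sq_add_cos_sq θ]
  have hmem {t : ℝ} (ht : t ∈ Ioo 0 θ) : t ∈ Ioo 0 (π / 2) := ⟨ht.1, ht.2.trans hθ.2⟩
  have hi (n : ℕ) : HasIntegralOn (fun t => 2 * cos t * (oddWallis n * sin t ^ (2 * n + 1)))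
      (Ioo 0 θ) (oddWallis n / (n + 1) * sin θ ^ (2 * n + 2)) := by
    refine (hasIntegralOn_Ioo_of_hasDerivAt_Icc
      (f := fun t => oddWallis n / (n + 1) * sin t ^ (2 * n + 2)) hθ.1.le (fun t _ => ?_)
      (by fun_prop)).of_eq (by simp)
    refine (((hasDerivAt_sin t).fun_pow (2 * n + 2)).const_mul _).congr_deriv ?_
    have : (n : ℝ) + 1 ≠ 0 := by positivity
    push_cast
    field_simp
  have hle (n : ℕ) : ∫ t in Ioo 0 θ, ‖2 * cos t * (oddWallis n * sin t ^ (2 * n + 1))‖ ≤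
      (sin θ ^ 2) ^ n * (π / 2) := by
    have h1 : ∫ t in Ioo 0 θ, ‖2 * cos t * (oddWallis n * sin t ^ (2 * n + 1))‖ =
        oddWallis n / (n + 1) * sin θ ^ (2 * n + 2) := by
      rw [← (hi n).2]
      refine setIntegral_congr_fun measurableSet_Ioo fun t ht => ?_
      have := sin_pos_of_mem_Ioo_pi_div_two (hmem ht)
      have := cos_pos_of_mem_Ioo_pi_div_two (hmem ht)
      have := oddWallis_nonneg n
      exact norm_of_nonneg (by positivity)
    rw [h1, pow_add, pow_mul, mul_comm]
    refine mul_le_mul (mul_le_of_le_one_right (by positivity) hlt.le) ?_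
      (div_nonneg (oddWallis_nonneg n) (by positivity)) (by positivity)
    exact (div_le_self (oddWallis_nonneg n) (by linarith [n.cast_nonneg (α := ℝ)])).trans
      (oddWallis_le n)
  have h := integrable_and_hasSum_integral measurableSet_Ioo (fun n => (hi n).1) hle
    ((summable_geometric_of_lt_one (by positivity) hlt).mul_right (π / 2))
    (F := fun t => 2 * t) (fun t ht => by
      have := cos_pos_of_mem_Ioo_pi_div_two (hmem ht)
      refine ((hasSum_oddWallis_mul_sin_pow (hmem ht)).mul_left (2 * cos t)).congr_sum ?_
      field_simp)
  have h2 : HasIntegralOn (fun t : ℝ => 2 * t) (Ioo 0 θ) (θ ^ 2) :=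
    (hasIntegralOn_Ioo_of_hasDerivAt_Icc (f := fun t => t ^ 2) hθ.1.le (fun t _ =>
      ((hasDerivAt_id' t).fun_pow 2).congr_deriv (by norm_num)) (by fun_prop)).of_eq (by simp)
  rw [h2.2] at h
  exact h.2.congr_fun fun n => (hi n).2.symm

theorem neg_log_tan_half_mul_sin_mem {t : ℝ} (ht : t ∈ Ioo 0 (π / 2)) :
    -log (tan (t / 2)) * sin t ∈ Icc 0 2 := by
  have hm : t / 2 ∈ Ioo 0 (π / 2) := ⟨half_pos ht.1, by linarith [ht.1, ht.2]⟩
  have hs := sin_pos_of_mem_Ioo_pi_div_two hm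
  have hc := cos_pos_of_mem_Ioo_pi_div_two hm
  have htan : 0 < tan (t / 2) := tan_pos_of_pos_of_lt_pi_div_two hm.1 hm.2
  have h1 : tan (t / 2) ≤ 1 := by
    rw [← tan_pi_div_four]
    exact (tan_lt_tan_of_lt_of_lt_pi_div_two (by linarith [hm.1, pi_pos])
      (by linarith [pi_pos]) (by linarith [ht.2])).le
  constructor
  · exact mul_nonneg (neg_nonneg.2 (log_nonpos htan.le h1)) (sin_pos_of_mem_Ioo_pi_div_two ht).le
  · have h2 := log_le_sub_one_of_pos (inv_pos.2 htan)
    rw [log_inv] at h2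
    have h3 : (tan (t / 2))⁻¹ * sin t = 2 * cos (t / 2) ^ 2 := by
      have : sin t = 2 * sin (t / 2) * cos (t / 2) := by rw [← sin_two_mul]; congr 1; ring
      rw [this, tan_eq_sin_div_cos]
      field_simp
    have h4 := sin_pos_of_mem_Ioo_pi_div_two ht
    nlinarith [cos_sq_le_one (t / 2)]

theorem hasDerivAt_log_tan_half {t : ℝ} (ht : t ∈ Ioo 0 (π / 2)) :
    HasDerivAt (fun t => log (tan (t / 2))) (1 / sin t) t := by
  have hm : t / 2 ∈ Ioo 0 (π / 2) := ⟨half_pos ht.1, by linarith [ht.1, ht.2]⟩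
  have hs := sin_pos_of_mem_Ioo_pi_div_two hm
  have hc := cos_pos_of_mem_Ioo_pi_div_two hm
  have htan : 0 < tan (t / 2) := tan_pos_of_pos_of_lt_pi_div_two hm.1 hm.2
  have h := (hasDerivAt_tan hc.ne').comp t ((hasDerivAt_id' t).div_const 2)
  refine (HasDerivAt.log (f := fun t => tan (t / 2)) h htan.ne').congr_deriv ?_
  have : sin t = 2 * sin (t / 2) * cos (t / 2) := by rw [← sin_two_mul]; congr 1; ring
  rw [this, tan_eq_sin_div_cos]
  field_simp

theorem integral_cot_mul_log_tan_mul_sin_pow (n : ℕ) :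
    HasIntegralOn (fun t => cos t / sin t * log (tan (t / 2)) * sin t ^ (2 * n + 2))
      (Ioo 0 (π / 2)) (-(oddWallis n / (2 * n + 2))) := by
  have hp : 0 < π / 2 := by positivity
  have hN : (2 * n + 2 : ℝ) ≠ 0 := by positivity
  have hint : IntegrableOn (fun t => cos t / sin t * log (tan (t / 2)) * sin t ^ (2 * n + 2))
      (Ioo 0 (π / 2)) := by
    refine Measure.integrableOn_of_bounded (M := 2) (by simp)
      (by simp only [tan_eq_sin_div_cos]; exact Measurable.aestronglyMeasurable (by fun_prop)) ?_
    refine (ae_restrict_iff' measurableSet_Ioo).2 (Eventually.of_forall fun t ht => ?_)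
    have hs := sin_pos_of_mem_Ioo_pi_div_two ht
    have hc := cos_pos_of_mem_Ioo_pi_div_two ht
    have h := neg_log_tan_half_mul_sin_mem ht
    have h1 : cos t / sin t * log (tan (t / 2)) * sin t ^ (2 * n + 2) =
        -((-log (tan (t / 2)) * sin t) * (cos t * sin t ^ (2 * n))) := by
      field_simp
      ring
    have h2 : cos t * sin t ^ (2 * n) ≤ 1 :=
      mul_le_one₀ (cos_le_one t) (by positivity) (pow_le_one₀ hs.le (sin_le_one t))
    rw [h1, norm_neg, norm_of_nonneg (mul_nonneg h.1 (by positivity))]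
    exact (mul_le_of_le_one_right h.1 h2).trans h.2
  have hw := (hasIntegralOn_sin_pow_odd n).const_mul (1 / (2 * n + 2))
  have h := hasIntegralOn_Ioo_of_hasDerivAt
    (f := fun t => log (tan (t / 2)) * (sin t ^ (2 * n + 2) / (2 * n + 2))) (u := 0) (v := 0)
    (f' := fun t => 1 / (2 * n + 2) * sin t ^ (2 * n + 1) +
      cos t / sin t * log (tan (t / 2)) * sin t ^ (2 * n + 2)) hp (fun t ht => ?_)
    (hw.1.add hint) ?_ ?_
  · exact (h.sub hw).congr measurableSet_Ioo (fun t _ => by ring) (by ring)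
  · have hs := sin_pos_of_mem_Ioo_pi_div_two ht
    refine ((hasDerivAt_log_tan_half ht).fun_mul
      (((hasDerivAt_sin t).fun_pow (2 * n + 2)).div_const (2 * n + 2))).congr_deriv ?_
    push_cast
    field_simp
    ring
  · have h0 : Tendsto (fun t => 2 * sin t) (𝓝[>] 0) (𝓝 0) := by
      have : Tendsto (fun t => 2 * sin t) (𝓝 0) (𝓝 (2 * sin 0)) :=
        Continuous.tendsto (by fun_prop) 0
      rw [sin_zero, mul_zero] at this
      exact this.mono_left nhdsWithin_le_nhds
    refine squeeze_zero_norm' ?_ h0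
    filter_upwards [Ioo_mem_nhdsGT hp] with t ht
    have hs := sin_pos_of_mem_Ioo_pi_div_two ht
    have h := neg_log_tan_half_mul_sin_mem ht
    have h1 : log (tan (t / 2)) * (sin t ^ (2 * n + 2) / (2 * n + 2)) =
        -((-log (tan (t / 2)) * sin t) * (sin t * (sin t ^ (2 * n) / (2 * n + 2)))) := by
      ring
    have h2 : sin t ^ (2 * n) / (2 * n + 2) ≤ 1 := by
      rw [div_le_one (by positivity)]
      exact (pow_le_one₀ hs.le (sin_le_one t)).trans (by linarith [n.cast_nonneg (α := ℝ)])
    rw [h1, norm_neg, norm_of_nonneg (mul_nonneg h.1 (by positivity))]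
    exact mul_le_mul h.2 (mul_le_of_le_one_right hs.le h2) (by positivity) zero_le_two
  · have htan : ContinuousAt (fun t => tan (t / 2)) (π / 2) := by
      refine ContinuousAt.comp (f := fun t : ℝ => t / 2) (continuousAt_tan.2 ?_) (by fun_prop)
      rw [show π / 2 / 2 = π / 4 by ring, cos_pi_div_four]
      positivity
    have h1 : tan (π / 2 / 2) = 1 := by rw [show π / 2 / 2 = π / 4 by ring, tan_pi_div_four]
    have hcont : ContinuousAt (fun t => log (tan (t / 2)) * (sin t ^ (2 * n + 2) / (2 * n + 2)))
        (π / 2) := (htan.log (by rw [h1]; exact one_ne_zero)).mul (by fun_prop)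
    convert hcont.tendsto.mono_left (nhdsWithin_le_nhds (s := Iio (π / 2))) using 2
    rw [h1, log_one, zero_mul]

theorem hasSum_oddWallis_sq :
    HasSum (fun n : ℕ => 2 * oddWallis n ^ 2 / (n + 1) ^ 2)
      (-4 * ∫ t in Ioo 0 (π / 2), t ^ 2 * (cos t / sin t) * log (tan (t / 2))) := by
  have hi (n : ℕ) := (integral_cot_mul_log_tan_mul_sin_pow n).const_mul (oddWallis n / (n + 1))
  have hle (n : ℕ) : ∫ t in Ioo 0 (π / 2), ‖oddWallis n / (n + 1) *
      (cos t / sin t * log (tan (t / 2)) * sin t ^ (2 * n + 2))‖ ≤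
      π ^ 2 / 8 * (1 / (n + 1 : ℝ) ^ 2) := by
    have h1 : ∫ t in Ioo 0 (π / 2), ‖oddWallis n / (n + 1) *
        (cos t / sin t * log (tan (t / 2)) * sin t ^ (2 * n + 2))‖ =
        -(oddWallis n / (n + 1) * -(oddWallis n / (2 * n + 2))) := by
      rw [← (hi n).2, ← integral_neg]
      refine setIntegral_congr_fun measurableSet_Ioo fun t ht => ?_
      have hs := sin_pos_of_mem_Ioo_pi_div_two ht
      have hc := cos_pos_of_mem_Ioo_pi_div_two ht
      have hw := oddWallis_nonneg n
      have h := (neg_log_tan_half_mul_sin_mem ht).1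
      have hl : log (tan (t / 2)) ≤ 0 := by nlinarith
      refine norm_of_nonpos (mul_nonpos_of_nonneg_of_nonpos (by positivity) ?_)
      exact mul_nonpos_of_nonpos_of_nonneg (mul_nonpos_of_nonneg_of_nonpos (by positivity) hl)
        (by positivity)
    have h2 : oddWallis n ^ 2 ≤ (π / 2) ^ 2 :=
      pow_le_pow_left₀ (oddWallis_nonneg n) (oddWallis_le n) 2
    calc _ = oddWallis n ^ 2 * (1 / (2 * (n + 1) ^ 2)) := by rw [h1]; field_simp
      _ ≤ (π / 2) ^ 2 * (1 / (2 * (n + 1) ^ 2)) := by gcongr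
      _ = _ := by field_simp; norm_num
  have h := integrable_and_hasSum_integral measurableSet_Ioo (fun n => (hi n).1) hle
    ((summable_one_div_succ_pow (by norm_num)).mul_left (π ^ 2 / 8))
    (F := fun t => t ^ 2 * (cos t / sin t) * log (tan (t / 2))) (fun t ht => by
      refine (((hasSum_oddWallis_mul_sin_pow_div ht).mul_right
        (cos t / sin t * log (tan (t / 2)))).congr_fun fun n => ?_).congr_sum ?_ <;> ring)
  refine (h.2.mul_left (-4)).congr_fun fun n => ?_
  rw [(hi n).2]
  field_simp
  ring

theorem setLIntegral_eq_of_subset_of_eqOn_zero {f : ℝ → ENNReal} {s t : Set ℝ}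
    (hs : MeasurableSet s) (ht : MeasurableSet t) (hst : s ⊆ t) (h : EqOn f 0 (t \ s)) :
    ∫⁻ x in s, f x = ∫⁻ x in t, f x := by
  rw [← lintegral_inter_add_sdiff f t hs, setLIntegral_eq_zero (ht.diff hs) h, add_zero,
    inter_eq_self_of_subset_right hst]

theorem image_arccos_mul_sin {k : ℝ} (hk : k ∈ Ioo 0 1) :
    (fun t => arccos (k * sin t)) '' Ioo 0 (π / 2) = Ioo (arccos k) (π / 2) := by
  have hk0 := hk.1
  have hk1 := hk.2
  ext b
  simp only [mem_image]
  constructor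
  · rintro ⟨t, ht, rfl⟩
    have hs := sin_pos_of_mem_Ioo_pi_div_two ht
    have h1 : sin t < 1 := by
      nlinarith [sin_sq_add_cos_sq t, sq_pos_of_pos (cos_pos_of_mem_Ioo_pi_div_two ht)]
    refine ⟨strictAntiOn_arccos ⟨by nlinarith, by nlinarith⟩ ⟨by linarith, hk1.le⟩ (by nlinarith),
      ?_⟩
    exact arccos_lt_pi_div_two.2 (by positivity)
  · rintro ⟨h1, h2⟩
    have hb0 : 0 < b := (arccos_nonneg k).trans_lt h1
    have hb : b ∈ Ioo 0 (π / 2) := ⟨hb0, h2⟩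
    have hc := cos_pos_of_mem_Ioo_pi_div_two hb
    have hck : cos b < k := by
      rw [← cos_arccos (by linarith) hk1.le]
      exact strictAntiOn_cos ⟨arccos_nonneg k, arccos_le_pi k⟩ ⟨hb0.le, by linarith⟩ h1
    have hlt : cos b / k < 1 := (div_lt_one hk0).2 hck
    have hpos : 0 < cos b / k := div_pos hc hk0
    refine ⟨arcsin (cos b / k), ⟨arcsin_pos.2 hpos, arcsin_lt_pi_div_two.2 hlt⟩, ?_⟩
    rw [sin_arcsin (by linarith) hlt.le, mul_div_cancel₀ _ hk0.ne', arccos_cos hb0.le (by linarith)]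

theorem lintegral_elliptic_kernel {k : ℝ} (hk : k ∈ Ioo 0 1) :
    ∫⁻ t in Ioo 0 (π / 2), ENNReal.ofReal (1 / √(1 - k ^ 2 * sin t ^ 2)) =
      ∫⁻ b in Ioo 0 (π / 2), ENNReal.ofReal (1 / √(sin b ^ 2 - (1 - k ^ 2))) := by
  have hk0 := hk.1
  have hk1 := hk.2
  have hlt {t : ℝ} (ht : t ∈ Ioo 0 (π / 2)) : 0 < k * sin t ∧ k * sin t < 1 := by
    have hs := sin_pos_of_mem_Ioo_pi_div_two ht
    exact ⟨by positivity, by nlinarith [sin_le_one t]⟩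
  have hz : EqOn (fun b => ENNReal.ofReal (1 / √(sin b ^ 2 - (1 - k ^ 2)))) 0
      (Ioo 0 (π / 2) \ Ioo (arccos k) (π / 2)) := by
    rintro b ⟨hb, hb2⟩
    have hle : b ≤ arccos k := not_lt.1 fun h => hb2 ⟨h, hb.2⟩
    have hc : k ≤ cos b := by
      rw [← cos_arccos (by linarith) hk1.le]
      exact cos_le_cos_of_nonneg_of_le_pi hb.1.le (arccos_le_pi k) hle
    have : sin b ^ 2 - (1 - k ^ 2) ≤ 0 := by nlinarith [sin_sq_add_cos_sq b]
    simp [sqrt_eq_zero_of_nonpos this]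
  rw [← setLIntegral_eq_of_subset_of_eqOn_zero measurableSet_Ioo measurableSet_Ioo
    (Ioo_subset_Ioo_left (arccos_nonneg k)) hz, ← image_arccos_mul_sin hk,
    lintegral_image_eq_lintegral_abs_deriv_mul measurableSet_Ioo
      (f' := fun t => -(1 / √(1 - (k * sin t) ^ 2)) * (k * cos t)) ?_ ?_]
  · refine setLIntegral_congr_fun measurableSet_Ioo fun t ht => ?_
    have hc := cos_pos_of_mem_Ioo_pi_div_two ht
    have h := hlt ht
    rw [← ENNReal.ofReal_mul (abs_nonneg _), sin_arccos, sq_sqrt (by nlinarith)]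
    have h1 : 1 - (k * sin t) ^ 2 - (1 - k ^ 2) = (k * cos t) ^ 2 := by
      linear_combination k ^ 2 * (-sin_sq_add_cos_sq t)
    have hp : 0 < √(1 - (k * sin t) ^ 2) := sqrt_pos.2 (by nlinarith)
    rw [h1, sqrt_sq (by positivity), neg_mul, abs_neg, abs_of_nonneg (by positivity), mul_pow]
    congr 1
    field_simp
  · intro t ht
    have h := hlt ht
    exact ((hasDerivAt_arccos (by linarith) h.2.ne).comp t
      ((hasDerivAt_sin t).const_mul k)).hasDerivWithinAt
  · intro a ha b hb hab
    have h := arccos_injOn ⟨by linarith [(hlt ha).1], (hlt ha).2.le⟩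
      ⟨by linarith [(hlt hb).1], (hlt hb).2.le⟩ hab
    exact injOn_sin ⟨by linarith [ha.1, pi_pos], ha.2.le⟩ ⟨by linarith [hb.1, pi_pos], hb.2.le⟩
      (mul_left_cancel₀ hk0.ne' h)

theorem ofReal_ellipticK {x : ℝ} (hx : x ∈ Ioo 0 1) :
    ENNReal.ofReal (ellipticK (1 - x)) =
      ∫⁻ b in Ioo 0 (π / 2), ENNReal.ofReal (1 / √(sin b ^ 2 - x)) := by
  have hx0 := hx.1
  have hx1 := hx.2
  have hpos (t : ℝ) : 0 < 1 - (1 - x) * sin t ^ 2 := by nlinarith [sin_sq_le_one t]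
  have hk : √(1 - x) ∈ Ioo 0 1 :=
    ⟨sqrt_pos.2 (by linarith), (sqrt_lt' one_pos).2 (by linarith)⟩
  have hsq : √(1 - x) ^ 2 = 1 - x := sq_sqrt (by linarith)
  have h := lintegral_elliptic_kernel hk
  rw [hsq, sub_sub_cancel] at h
  rw [← h, ellipticK, intervalIntegral.integral_of_le (by positivity),
    integral_Ioc_eq_integral_Ioo, ofReal_integral_eq_lintegral_ofReal]
  · exact integrableOn_Ioo_of_continuousOn_Icc (ContinuousOn.div (by fun_prop) (by fun_prop)
      fun t _ => (sqrt_pos.2 (hpos t)).ne')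
  · exact Eventually.of_forall fun t => by positivity

theorem image_mul_sin_sq {s : ℝ} (hs : 0 < s) :
    (fun t => s ^ 2 * sin t ^ 2) '' Ioo 0 (π / 2) = Ioo 0 (s ^ 2) := by
  ext x
  simp only [mem_image]
  constructor
  · rintro ⟨t, ht, rfl⟩
    have := sin_pos_of_mem_Ioo_pi_div_two ht
    exact ⟨by positivity, by
      nlinarith [sin_sq_add_cos_sq t, sq_pos_of_pos (cos_pos_of_mem_Ioo_pi_div_two ht),
        mul_pos (sq_pos_of_pos hs) (sq_pos_of_pos (cos_pos_of_mem_Ioo_pi_div_two ht))]⟩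
  · rintro ⟨h1, h2⟩
    have hpos : 0 < √x / s := div_pos (sqrt_pos.2 h1) hs
    have hlt : √x / s < 1 := (div_lt_one hs).2 ((sqrt_lt' hs).2 h2)
    refine ⟨arcsin (√x / s), ⟨arcsin_pos.2 hpos, arcsin_lt_pi_div_two.2 hlt⟩, ?_⟩
    rw [sin_arcsin (by linarith) hlt.le, div_pow, sq_sqrt h1.le]
    field_simp

theorem lintegral_pow_div_sqrt (n : ℕ) {s : ℝ} (hs : s ∈ Ioo 0 1) :
    ∫⁻ x in Ioo 0 1, ENNReal.ofReal (x ^ n * (1 / √(s ^ 2 - x))) =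
      ENNReal.ofReal (2 * s ^ (2 * n + 1) * oddWallis n) := by
  have hs0 := hs.1
  have hs1 := hs.2
  rw [← setLIntegral_eq_of_subset_of_eqOn_zero (s := Ioo 0 (s ^ 2)) measurableSet_Ioo
    measurableSet_Ioo (Ioo_subset_Ioo_right (by nlinarith)) ?_, ← image_mul_sin_sq hs0,
    lintegral_image_eq_lintegral_abs_deriv_mul measurableSet_Ioo
      (f' := fun t => s ^ 2 * (2 * sin t * cos t)) ?_ ?_,
    ← ((hasIntegralOn_sin_pow_odd n).const_mul (2 * s ^ (2 * n + 1))).2,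
    ofReal_integral_eq_lintegral_ofReal
      ((hasIntegralOn_sin_pow_odd n).const_mul (2 * s ^ (2 * n + 1))).1 ?_]
  · refine setLIntegral_congr_fun measurableSet_Ioo fun t ht => ?_
    have hc := cos_pos_of_mem_Ioo_pi_div_two ht
    have hp := sin_pos_of_mem_Ioo_pi_div_two ht
    rw [← ENNReal.ofReal_mul (abs_nonneg _), abs_of_nonneg (by positivity)]
    have h1 : s ^ 2 - s ^ 2 * sin t ^ 2 = (s * cos t) ^ 2 := by
      linear_combination s ^ 2 * (-sin_sq_add_cos_sq t)
    rw [h1, sqrt_sq (by positivity)]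
    congr 1
    field_simp
    ring
  · refine (ae_restrict_iff' measurableSet_Ioo).2 (Eventually.of_forall fun t ht => ?_)
    have hp := sin_pos_of_mem_Ioo_pi_div_two ht
    simp only [Pi.zero_apply]
    positivity
  · intro t _
    refine (((hasDerivAt_sin t).fun_pow 2).const_mul (s ^ 2)).congr_deriv ?_ |>.hasDerivWithinAt
    push_cast
    ring
  · intro a ha b hb hab
    have h := mul_left_cancel₀ (pow_ne_zero 2 hs0.ne') hab
    have h1 := (pow_left_inj₀ (sin_pos_of_mem_Ioo_pi_div_two ha).le
      (sin_pos_of_mem_Ioo_pi_div_two hb).le two_ne_zero).1 h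
    exact injOn_sin ⟨by linarith [ha.1, pi_pos], ha.2.le⟩ ⟨by linarith [hb.1, pi_pos], hb.2.le⟩ h1
  · rintro x ⟨hx, hx2⟩
    have hle : s ^ 2 ≤ x := not_lt.1 fun h => hx2 ⟨hx.1, h⟩
    simp [sqrt_eq_zero_of_nonpos (sub_nonpos.2 hle)]

theorem lintegral_pow_mul_ellipticK (n : ℕ) :
    ∫⁻ x in Ioo 0 1, ENNReal.ofReal (x ^ n * ellipticK (1 - x)) =
      ENNReal.ofReal (2 * oddWallis n ^ 2) := by
  have hw := oddWallis_nonneg n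
  have h1 : ∫⁻ x in Ioo 0 1, ENNReal.ofReal (x ^ n * ellipticK (1 - x)) =
      ∫⁻ x in Ioo 0 1, ∫⁻ b in Ioo 0 (π / 2),
        ENNReal.ofReal (x ^ n * (1 / √(sin b ^ 2 - x))) := by
    refine setLIntegral_congr_fun measurableSet_Ioo fun x hx => ?_
    have hx0 : 0 ≤ x ^ n := pow_nonneg hx.1.le n
    simp only [ENNReal.ofReal_mul hx0]
    rw [lintegral_const_mul _ (by fun_prop), ofReal_ellipticK hx]
  have h2 : ∫⁻ b in Ioo 0 (π / 2), ∫⁻ x in Ioo 0 1,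
      ENNReal.ofReal (x ^ n * (1 / √(sin b ^ 2 - x))) =
      ∫⁻ b in Ioo 0 (π / 2), ENNReal.ofReal (2 * oddWallis n * sin b ^ (2 * n + 1)) := by
    refine setLIntegral_congr_fun measurableSet_Ioo fun b hb => ?_
    have hs := sin_pos_of_mem_Ioo_pi_div_two hb
    have hlt : sin b < 1 := by
      nlinarith [sin_sq_add_cos_sq b, sq_pos_of_pos (cos_pos_of_mem_Ioo_pi_div_two hb)]
    rw [lintegral_pow_div_sqrt n ⟨hs, hlt⟩]
    congr 1
    ring
  have h3 := (hasIntegralOn_sin_pow_odd n).const_mul (2 * oddWallis n)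
  rw [h1, lintegral_lintegral_swap (Measurable.aemeasurable (by
    unfold Function.uncurry; fun_prop)), h2, ← ofReal_integral_eq_lintegral_ofReal h3.1, h3.2]
  · congr 1
    ring
  · refine (ae_restrict_iff' measurableSet_Ioo).2 (Eventually.of_forall fun t ht => ?_)
    have hp := sin_pos_of_mem_Ioo_pi_div_two ht
    simp only [Pi.zero_apply]
    positivity

theorem ellipticK_nonneg (m : ℝ) : 0 ≤ ellipticK m :=
  intervalIntegral.integral_nonneg (by positivity) fun _ _ => by positivity

theorem measurable_ellipticK : Measurable ellipticK := by
  have h : ellipticK = fun m => ∫ t in Ioc 0 (π / 2), 1 / √(1 - m * sin t ^ 2) := by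
    ext m
    rw [ellipticK, intervalIntegral.integral_of_le (by positivity)]
  rw [h]
  refine (StronglyMeasurable.integral_prod_right (Measurable.stronglyMeasurable ?_)).measurable
  unfold Function.uncurry
  fun_prop

theorem integral_pow_mul_ellipticK (n : ℕ) :
    HasIntegralOn (fun x => x ^ n * ellipticK (1 - x)) (Ioo 0 1) (2 * oddWallis n ^ 2) := by
  have hm : AEStronglyMeasurable (fun x => x ^ n * ellipticK (1 - x))
      (volume.restrict (Ioo 0 1)) :=
    ((measurable_id.pow_const n).mul
      (measurable_ellipticK.comp (measurable_const.sub measurable_id))).aestronglyMeasurable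
  have h0 : 0 ≤ᵐ[volume.restrict (Ioo 0 1)] fun x => x ^ n * ellipticK (1 - x) :=
    (ae_restrict_iff' measurableSet_Ioo).2 (Eventually.of_forall fun x hx =>
      mul_nonneg (pow_nonneg hx.1.le n) (ellipticK_nonneg _))
  have hl := lintegral_pow_mul_ellipticK n
  constructor
  · refine (lintegral_ofReal_ne_top_iff_integrable hm h0).1 ?_
    rw [hl]
    exact ENNReal.ofReal_ne_top
  · rw [integral_eq_lintegral_of_nonneg_ae h0 hm, hl, ENNReal.toReal_ofReal (by positivity)]

theorem integral_ellipticK_mul_dilog :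
    ∫ x in Ioo 0 1, ellipticK (1 - x) * rpolylog 2 x / x =
      -4 * ∫ t in Ioo 0 (π / 2), t ^ 2 * (cos t / sin t) * log (tan (t / 2)) := by
  have hi (n : ℕ) := (integral_pow_mul_ellipticK n).const_mul (1 / (n + 1 : ℝ) ^ 2)
  have hle (n : ℕ) : ∫ x in Ioo 0 1, ‖1 / (n + 1 : ℝ) ^ 2 * (x ^ n * ellipticK (1 - x))‖ ≤
      2 * oddWallis n ^ 2 / (n + 1) ^ 2 := by
    have h1 : ∫ x in Ioo 0 1, ‖1 / (n + 1 : ℝ) ^ 2 * (x ^ n * ellipticK (1 - x))‖ =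
        1 / (n + 1) ^ 2 * (2 * oddWallis n ^ 2) := by
      rw [← (hi n).2]
      exact setIntegral_congr_fun measurableSet_Ioo fun x hx => norm_of_nonneg
        (mul_nonneg (by positivity) (mul_nonneg (pow_nonneg hx.1.le n) (ellipticK_nonneg _)))
    rw [h1]
    exact le_of_eq (by ring)
  have h := integrable_and_hasSum_integral measurableSet_Ioo (fun n => (hi n).1) hle
    hasSum_oddWallis_sq.summable
    (F := fun x => ellipticK (1 - x) * rpolylog 2 x / x) (fun x hx => by
      have hx0 := hx.1.ne'
      have hs : Summable fun n : ℕ => x ^ (n + 1) / ((n + 1 : ℕ) : ℝ) ^ 2 := by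
        refine (summable_one_div_succ_pow one_lt_two).of_norm_bounded fun n => ?_
        rw [norm_of_nonneg (div_nonneg (pow_nonneg hx.1.le _) (by positivity))]
        push_cast
        gcongr
        exact pow_le_one₀ hx.1.le hx.2.le
      refine ((hs.hasSum.mul_left (ellipticK (1 - x) / x)).congr_fun fun n => ?_).congr_sum ?_
      · push_cast
        field_simp
        ring
      · rw [rpolylog]
        ring)
  exact h.2.unique (hasSum_oddWallis_sq.congr_fun fun n => by rw [(hi n).2]; ring)

theorem integral_ellipticK_mul_dilog_eq :
    (∫ x in (0 : ℝ)..1, ellipticK (1 - x) * rpolylog 2 x / x)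
      = -32 * Real.pi * (cpolylog 3 ((1 + Complex.I) / 2)).im
        + 32 * rpolylog 4 (1 / 2) + 41 * Real.pi ^ 4 / 90
        + 4 / 3 * Real.log 2 ^ 4 - 1 / 3 * Real.pi ^ 2 * Real.log 2 ^ 2 := by
  rw [intervalIntegral.integral_of_le zero_le_one, integral_Ioc_eq_integral_Ioo,
    integral_ellipticK_mul_dilog, integral_sq_mul_cot_mul_log_tan.2.2,
    integral_log_mul_arctan_eq_im_cpolylog]
  ring

end

/-- `∫₀¹ K(1−x)·Li₂(x)/x dx = −32π·Im(Li₃((1+i)/2)) + 32·Li₄(1/2)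
+ 41π⁴/90 + (4/3)log⁴2 − (1/3)π²·log²2`. -/
theorem statement19 :
    (∫ x in (0 : ℝ)..1, ellipticK (1 - x) * rpolylog 2 x / x)
      = -32 * Real.pi * (cpolylog 3 ((1 + Complex.I) / 2)).im
        + 32 * rpolylog 4 (1 / 2) + 41 * Real.pi ^ 4 / 90
        + 4 / 3 * Real.log 2 ^ 4 - 1 / 3 * Real.pi ^ 2 * Real.log 2 ^ 2 := by
  exact integral_ellipticK_mul_dilog_eq
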